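/- arXiv:2005.02879 — 15 statements merged into one kernel-verified Lean document; each statement's English description precedes it below -/
import Mathlib

section
/- Let (Θ,τ), (𝒦,μ) and (𝒳,ν) be measure spaces with σ-finite measures. Let π:Θ→[0,∞), g:Θ×𝒦→[0,∞) and f:𝒦×𝒳→[0,∞) be measurable functions with ∫_Θ π dτ = 1, ∫_𝒦 g(θ,k) dμ(k) = 1 for every θ, and ∫_𝒳 f(k,x) dν(x) = 1 for every k. Fix x ∈ 𝒳, define m_π(k) = ∫_Θ g(θ,k) π(θ) dτ(θ) and Z = ∫_𝒦 f(k,x) m_π(k) dμ(k), and assume 0 < Z < ∞ and that m_π(k) ∈ (0,∞) for μ-almost every k. Then (i) Z = ∫_Θ π(θ) (∫_𝒦 f(k,x) g(θ,k) dμ(k)) dτ(θ), so Z is the normalizing constant of the posterior; and (ii) for every θ ∈ Θ, the posterior density π(θ|x) := π(θ) (∫_𝒦 f(k,x) g(θ,k) dμ(k)) / Z satisfies π(θ|x) = ∫_𝒦 π_k(θ) f'_x(k) dμ(k), where π_k(θ) = π(θ) g(θ,k)/m_π(k) and f'_x(k) = f(k,x) m_π(k)/Z (defined to be 0 where m_π(k)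 ∉ (0,∞)). -/
open MeasureTheory ENNReal

/-- Theorem 3.1(a): for Type I mixtures, the posterior of θ given x is a mixture of the
conditional posteriors π_k with mixing density f'_x. -/
theorem typeI_posterior_mixture
    {Θ K X : Type*} [MeasurableSpace Θ] [MeasurableSpace K] [MeasurableSpace X]
    (τ : Measure Θ) (μ : Measure K) (ν : Measure X)
    [SigmaFinite τ] [SigmaFinite μ] [SigmaFinite ν]
    (π : Θ → ℝ≥0∞) (g : Θ → K → ℝ≥0∞) (f : K → X → ℝ≥0∞)
    (hπmeas : Measurable π)
    (hgmeas : Measurable (Function.uncurry g))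
    (hfmeas : Measurable (Function.uncurry f))
    (hπ1 : ∫⁻ θ, π θ ∂τ = 1)
    (hg1 : ∀ θ, ∫⁻ k, g θ k ∂μ = 1)
    (hf1 : ∀ k, ∫⁻ y, f k y ∂ν = 1)
    (x : X)
    (m : K → ℝ≥0∞) (hm : ∀ k, m k = ∫⁻ θ, g θ k * π θ ∂τ)
    (Z : ℝ≥0∞) (hZ : Z = ∫⁻ k, f k x * m k ∂μ)
    (hZpos : 0 < Z) (hZfin : Z < ⊤)
    (hmae : ∀ᵐ k ∂μ, 0 < m k ∧ m k < ⊤)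
    (πk : K → Θ → ℝ≥0∞) (f'x : K → ℝ≥0∞)
    (hπk : ∀ k, (0 < m k ∧ m k < ⊤) → ∀ θ, πk k θ = π θ * g θ k / m k)
    (hπk0 : ∀ k, ¬ (0 < m k ∧ m k < ⊤) → ∀ θ, πk k θ = 0)
    (hf'x : ∀ k, (0 < m k ∧ m k < ⊤) → f'x k = f k x * m k / Z)
    (hf'x0 : ∀ k, ¬ (0 < m k ∧ m k < ⊤) → f'x k = 0) :
    Z = ∫⁻ θ, π θ * (∫⁻ k, f k x * g θ k ∂μ) ∂τ ∧
      ∀ θ, π θ * (∫⁻ k, f k x * g θ k ∂μ) / Z = ∫⁻ k, πk k θ * f'x k ∂μ := by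
  have hfx : Measurable fun k => f k x := hfmeas.comp measurable_prodMk_right
  have hfg : ∀ θ, Measurable fun k => f k x * g θ k :=
    fun θ => hfx.mul (hgmeas.comp measurable_prodMk_left)
  have hgπ : ∀ k, Measurable fun θ => g θ k * π θ :=
    fun k => (hgmeas.comp measurable_prodMk_right).mul hπmeas
  refine ⟨?_, fun θ => ?_⟩
  · calc
      Z = ∫⁻ k, ∫⁻ θ, f k x * (g θ k * π θ) ∂τ ∂μ := by
        rw [hZ]
        refine lintegral_congr fun k => ?_
        rw [hm, lintegral_const_mul _ (hgπ k)]
      _ = ∫⁻ θ, ∫⁻ k, f k x * (g θ k * π θ) ∂μ ∂τ := by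
        refine lintegral_lintegral_swap (Measurable.aemeasurable ?_)
        exact (hfx.comp measurable_fst).mul
          ((hgmeas.comp measurable_swap).mul (hπmeas.comp measurable_snd))
      _ = ∫⁻ θ, π θ * (∫⁻ k, f k x * g θ k ∂μ) ∂τ := by
        refine lintegral_congr fun θ => ?_
        rw [← lintegral_const_mul _ (hfg θ)]
        exact lintegral_congr fun k => by ring
  · rw [div_eq_mul_inv, ← lintegral_const_mul _ (hfg θ),
      ← lintegral_mul_const _ ((hfg θ).const_mul (π θ))]
    refine lintegral_congr_ae ?_
    filter_upwards [hmae] with k hk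
    rw [hπk k hk, hf'x k hk, div_eq_mul_inv, div_eq_mul_inv]
    calc
      π θ * (f k x * g θ k) * Z⁻¹ = π θ * (f k x * g θ k) * Z⁻¹ * ((m k)⁻¹ * m k) := by
        rw [ENNReal.inv_mul_cancel hk.1.ne' hk.2.ne, mul_one]
      _ = π θ * g θ k * (m k)⁻¹ * (f k x * m k * Z⁻¹) := by ring
end

section
/- Let (Θ,τ), (𝒦,μ), (𝒳,ν) and (𝒴,ν') be measure spaces with σ-finite measures. Let π:Θ→[0,∞), g:Θ×𝒦→[0,∞), f:𝒦×𝒳→[0,∞), h:Θ×𝒦→[0,∞) and q:𝒦×𝒴→[0,∞) be measurable with ∫_Θ π dτ = 1, ∫_𝒦 g(θ,k) dμ(k) = 1 and ∫_𝒦 h(θ,j) dμ(j) = 1 for every θ, ∫_𝒳 f(k,x) dν(x) = 1 and ∫_𝒴 q(j,y) dν'(y) = 1 for every k, j. Fix x ∈ 𝒳, set m_π(k) = ∫_Θ g(θ,k) π(θ) dτ(θ), Z = ∫_𝒦 f(k,x) m_π(k) dμ(k), and assume 0 < Z < ∞ and m_π(k) ∈ (0,∞) for μ-almost every k. Define the posterior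 π(θ|x) = π(θ)(∫_𝒦 f(k,x) g(θ,k) dμ(k))/Z, the densities π_k(θ) = π(θ) g(θ,k)/m_π(k) and f'_x(k) = f(k,x) m_π(k)/Z, and the predictive density q_π(y|x) = ∫_Θ (∫_𝒦 q(j,y) h(θ,j) dμ(j)) π(θ|x) dτ(θ). Then for every y ∈ 𝒴, q_π(y|x) = ∫_𝒦 q(j,y) h'_x(j) dμ(j), where h'_x(j) = ∫_𝒦 (∫_Θ h(θ,j) π_k(θ) dτ(θ)) f'_x(k) dμ(k); moreover ∫_𝒦 h'_x(j) dμ(j) = 1. -/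
open MeasureTheory ENNReal

/-- Mixing a nonnegative kernel against a weight commutes with a further integration. -/
theorem lintegral_mul_lintegral_mul_comm {α β : Type*} [MeasurableSpace α] [MeasurableSpace β]
    {μ : Measure α} {ν : Measure β} [SFinite μ] [SFinite ν]
    {a : α → ℝ≥0∞} {b : β → ℝ≥0∞} {c : β → α → ℝ≥0∞}
    (ha : Measurable a) (hb : Measurable b) (hc : Measurable (Function.uncurry c)) :
    ∫⁻ x, a x * ∫⁻ y, c y x * b y ∂ν ∂μ = ∫⁻ y, (∫⁻ x, a x * c y x ∂μ) * b y ∂ν := by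
  have hcx (x : α) : Measurable fun y => c y x := hc.comp measurable_prodMk_right
  have hcy (y : β) : Measurable fun x => c y x := hc.comp measurable_prodMk_left
  have hc' : Measurable fun p : α × β => c p.2 p.1 := hc.comp measurable_swap
  calc ∫⁻ x, a x * ∫⁻ y, c y x * b y ∂ν ∂μ
      = ∫⁻ x, ∫⁻ y, a x * (c y x * b y) ∂ν ∂μ :=
        lintegral_congr fun x => (lintegral_const_mul _ ((hcx x).mul hb)).symm
    _ = ∫⁻ y, ∫⁻ x, a x * (c y x * b y) ∂μ ∂ν :=
        lintegral_lintegral_swap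
          ((ha.comp measurable_fst).mul (hc'.mul (hb.comp measurable_snd))).aemeasurable
    _ = ∫⁻ y, (∫⁻ x, a x * c y x ∂μ) * b y ∂ν := lintegral_congr fun y => by
        simpa only [Pi.mul_apply, mul_assoc] using lintegral_mul_const (b y) (ha.mul (hcy y))

/-- Theorem 3.1(b): for Type I mixtures, the Bayes predictive density of Y given X = x
is a mixture of the component densities q(j,·) with posterior mixing density h'_x,
which itself integrates to one. -/
theorem typeI_predictive_mixture
    {Θ K X Y : Type*} [MeasurableSpace Θ] [MeasurableSpace K] [MeasurableSpace X]
    [MeasurableSpace Y]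
    (τ : Measure Θ) (μ : Measure K) (ν : Measure X) (ν' : Measure Y)
    [SigmaFinite τ] [SigmaFinite μ] [SigmaFinite ν] [SigmaFinite ν']
    (π : Θ → ℝ≥0∞) (g : Θ → K → ℝ≥0∞) (f : K → X → ℝ≥0∞)
    (h : Θ → K → ℝ≥0∞) (q : K → Y → ℝ≥0∞)
    (hπmeas : Measurable π)
    (hgmeas : Measurable (Function.uncurry g))
    (hfmeas : Measurable (Function.uncurry f))
    (hhmeas : Measurable (Function.uncurry h))
    (hqmeas : Measurable (Function.uncurry q))
    (hπ1 : ∫⁻ θ, π θ ∂τ = 1)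
    (hg1 : ∀ θ, ∫⁻ k, g θ k ∂μ = 1)
    (hh1 : ∀ θ, ∫⁻ j, h θ j ∂μ = 1)
    (hf1 : ∀ k, ∫⁻ y, f k y ∂ν = 1)
    (hq1 : ∀ j, ∫⁻ y, q j y ∂ν' = 1)
    (x : X)
    (m : K → ℝ≥0∞) (hm : ∀ k, m k = ∫⁻ θ, g θ k * π θ ∂τ)
    (Z : ℝ≥0∞) (hZ : Z = ∫⁻ k, f k x * m k ∂μ)
    (hZpos : 0 < Z) (hZfin : Z < ⊤)
    (hmae : ∀ᵐ k ∂μ, 0 < m k ∧ m k < ⊤)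
    (post : Θ → ℝ≥0∞)
    (hpost : ∀ θ, post θ = π θ * (∫⁻ k, f k x * g θ k ∂μ) / Z)
    (πk : K → Θ → ℝ≥0∞) (hπk : ∀ k θ, πk k θ = π θ * g θ k / m k)
    (f'x : K → ℝ≥0∞) (hf'x : ∀ k, f'x k = f k x * m k / Z)
    (qπ : Y → ℝ≥0∞)
    (hqπ : ∀ y, qπ y = ∫⁻ θ, (∫⁻ j, q j y * h θ j ∂μ) * post θ ∂τ)
    (h'x : K → ℝ≥0∞)
    (hh'x : ∀ j, h'x j = ∫⁻ k, (∫⁻ θ, h θ j * πk k θ ∂τ) * f'x k ∂μ) :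
    (∀ y, qπ y = ∫⁻ j, q j y * h'x j ∂μ) ∧ ∫⁻ j, h'x j ∂μ = 1 := by
  have hfx : Measurable fun k => f k x := hfmeas.comp measurable_prodMk_right
  have hhj (j : K) : Measurable fun θ => h θ j := hhmeas.comp measurable_prodMk_right
  have hqy (y : Y) : Measurable fun j => q j y := hqmeas.comp measurable_prodMk_right
  have hpost_meas : Measurable post := by
    rw [funext hpost]
    exact (hπmeas.mul ((hfx.comp measurable_snd).mul hgmeas).lintegral_prod_right').div_const Z
  have hpost_int : ∫⁻ θ, post θ ∂τ = 1 := by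
    have key : ∫⁻ θ, (∫⁻ k, f k x * g θ k ∂μ) * π θ ∂τ = Z := by
      rw [← lintegral_mul_lintegral_mul_comm hfx hπmeas hgmeas, hZ]
      simp only [hm]
    simp only [hpost, div_eq_mul_inv]
    rw [lintegral_mul_const' _ _ (inv_ne_top.2 hZpos.ne')]
    simp only [mul_comm (π _)]
    rw [key, ENNReal.mul_inv_cancel hZpos.ne' hZfin.ne]
  have hh'x_post (j : K) : h'x j = ∫⁻ θ, h θ j * post θ ∂τ := by
    calc h'x j = ∫⁻ k, (f k x * ∫⁻ θ, g θ k * (h θ j * π θ) ∂τ) * Z⁻¹ ∂μ := by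
          rw [hh'x]
          refine lintegral_congr_ae (hmae.mono fun k ⟨hk0, hkt⟩ => ?_)
          have hint : ∫⁻ θ, h θ j * πk k θ ∂τ =
              (∫⁻ θ, g θ k * (h θ j * π θ) ∂τ) * (m k)⁻¹ := by
            rw [← lintegral_mul_const' _ _ (inv_ne_top.2 hk0.ne')]
            refine lintegral_congr fun θ => ?_
            rw [hπk, div_eq_mul_inv]
            ring
          dsimp only
          rw [hint, hf'x, div_eq_mul_inv]
          calc _ = (f k x * ∫⁻ θ, g θ k * (h θ j * π θ) ∂τ) * Z⁻¹ * (m k * (m k)⁻¹) := by ring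
            _ = _ := by rw [ENNReal.mul_inv_cancel hk0.ne' hkt.ne, mul_one]
      _ = ∫⁻ θ, h θ j * post θ ∂τ := by
          rw [lintegral_mul_const' _ _ (inv_ne_top.2 hZpos.ne'),
            lintegral_mul_lintegral_mul_comm (b := fun θ => h θ j * π θ) hfx
              ((hhj j).mul hπmeas) hgmeas,
            ← lintegral_mul_const' _ _ (inv_ne_top.2 hZpos.ne')]
          refine lintegral_congr fun θ => ?_
          rw [hpost, div_eq_mul_inv]
          ring
  refine ⟨fun y => ?_, ?_⟩
  · simp only [hqπ, hh'x_post]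
    exact (lintegral_mul_lintegral_mul_comm (hqy y) hpost_meas hhmeas).symm
  · have := lintegral_mul_lintegral_mul_comm (μ := μ) (ν := τ) (measurable_const (a := 1))
      hpost_meas hhmeas
    simpa only [one_mul, hh1, hpost_int, ← hh'x_post] using this
end

section
/- Let (Θ,τ), (𝒦,μ), (𝒳,ν) and (𝒴,ν') be measure spaces with σ-finite measures. Let π:Θ→[0,∞), g:𝒦→[0,∞), h:𝒦→[0,∞), f:Θ×𝒦×𝒳→[0,∞) and q:Θ×𝒦×𝒴→[0,∞) be measurable with ∫_Θ π dτ = 1, ∫_𝒦 g dμ = ∫_𝒦 h dμ = 1, ∫_𝒳 f(θ,k,x) dν(x) = 1 and ∫_𝒴 q(θ,j,y) dν'(y) = 1 for every (θ,k), (θ,j). Fix x ∈ 𝒳, define m_{π,k}(x) = ∫_Θ f(θ,k,x) π(θ) dτ(θ) and Z = ∫_𝒦 g(k) m_{π,k}(x) dμ(k), assume 0 < Z < ∞ and m_{π,k}(x) ∈ (0,∞) for μ-almost every k with g(k) > 0, and set π(θ|x) = π(θ)(∫_𝒦 f(θ,k,x) g(k) dμ(k))/Z, π_{k,x}(θ)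 = π(θ) f(θ,k,x)/m_{π,k}(x), g_{π,x}(k) = g(k) m_{π,k}(x)/Z. Then for every y ∈ 𝒴, the Bayes predictive density q_π(y|x) := ∫_Θ (∫_𝒦 q(θ,j,y) h(j) dμ(j)) π(θ|x) dτ(θ) satisfies q_π(y|x) = ∫_𝒦 ∫_𝒦 q_π(y|j,k) h(j) g_{π,x}(k) dμ(j) dμ(k), where q_π(y|j,k) = ∫_Θ q(θ,j,y) π_{k,x}(θ) dτ(θ). -/
open MeasureTheory ENNReal

/-- Theorem 4.1(b): for Type II mixtures, the Bayes predictive density of Y given X = x is a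
bivariate mixture, over J' ~ h and K' ~ g_{π,x}, of the conditional Bayes predictive densities
q_π(·|j,k). -/
theorem typeII_predictive_mixture
    {Θ K X Y : Type*} [MeasurableSpace Θ] [MeasurableSpace K] [MeasurableSpace X]
    [MeasurableSpace Y]
    (τ : Measure Θ) (μ : Measure K) (ν : Measure X) (ν' : Measure Y)
    [SigmaFinite τ] [SigmaFinite μ] [SigmaFinite ν] [SigmaFinite ν']
    (π : Θ → ℝ≥0∞) (g : K → ℝ≥0∞) (h : K → ℝ≥0∞)
    (f : Θ → K → X → ℝ≥0∞) (q : Θ → K → Y → ℝ≥0∞)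
    (hπmeas : Measurable π)
    (hgmeas : Measurable g)
    (hhmeas : Measurable h)
    (hfmeas : Measurable (fun p : Θ × K × X => f p.1 p.2.1 p.2.2))
    (hqmeas : Measurable (fun p : Θ × K × Y => q p.1 p.2.1 p.2.2))
    (hπ1 : ∫⁻ θ, π θ ∂τ = 1)
    (hg1 : ∫⁻ k, g k ∂μ = 1)
    (hh1 : ∫⁻ j, h j ∂μ = 1)
    (hf1 : ∀ θ k, ∫⁻ y, f θ k y ∂ν = 1)
    (hq1 : ∀ θ j, ∫⁻ y, q θ j y ∂ν' = 1)
    (x : X)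
    (m : K → ℝ≥0∞) (hm : ∀ k, m k = ∫⁻ θ, f θ k x * π θ ∂τ)
    (Z : ℝ≥0∞) (hZ : Z = ∫⁻ k, g k * m k ∂μ)
    (hZpos : 0 < Z) (hZfin : Z < ⊤)
    (hmae : ∀ᵐ k ∂μ, 0 < g k → (0 < m k ∧ m k < ⊤))
    (post : Θ → ℝ≥0∞)
    (hpost : ∀ θ, post θ = π θ * (∫⁻ k, f θ k x * g k ∂μ) / Z)
    (πkx : K → Θ → ℝ≥0∞) (hπkx : ∀ k θ, πkx k θ = π θ * f θ k x / m k)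
    (gπx : K → ℝ≥0∞) (hgπx : ∀ k, gπx k = g k * m k / Z)
    (qπ : Y → ℝ≥0∞)
    (hqπ : ∀ y, qπ y = ∫⁻ θ, (∫⁻ j, q θ j y * h j ∂μ) * post θ ∂τ)
    (qπjk : K → K → Y → ℝ≥0∞)
    (hqπjk : ∀ j k y, qπjk j k y = ∫⁻ θ, q θ j y * πkx k θ ∂τ) :
    ∀ y, qπ y = ∫⁻ k, (∫⁻ j, qπjk j k y * h j ∂μ) * gπx k ∂μ := by
  intro y
  have hqy : Measurable (fun p : Θ × K => q p.1 p.2 y) :=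
    hqmeas.comp (measurable_fst.prodMk (measurable_snd.prodMk measurable_const))
  have hfx : Measurable (fun p : Θ × K => f p.1 p.2 x) :=
    hfmeas.comp (measurable_fst.prodMk (measurable_snd.prodMk measurable_const))
  have hfk (k : K) : Measurable (fun θ => f θ k x) := hfx.comp measurable_prodMk_right
  have hfθ (θ : Θ) : Measurable (fun k => f θ k x) := hfx.comp measurable_prodMk_left
  have hqj (j : K) : Measurable (fun θ => q θ j y) := hqy.comp measurable_prodMk_right
  have hqθ (θ : Θ) : Measurable (fun j => q θ j y) := hqy.comp measurable_prodMk_left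
  have hπk (k : K) : Measurable (πkx k) := by
    rw [funext (hπkx k)]
    exact (hπmeas.mul (hfk k)).div_const _
  set Q : Θ → ℝ≥0∞ := fun θ => ∫⁻ j, q θ j y * h j ∂μ with hQ
  have hQmeas : Measurable Q :=
    (hqy.mul (hhmeas.comp measurable_snd)).lintegral_prod_right'
  have hcond (k : K) : ∫⁻ j, qπjk j k y * h j ∂μ = ∫⁻ θ, Q θ * πkx k θ ∂τ := by
    calc ∫⁻ j, qπjk j k y * h j ∂μ
        = ∫⁻ j, ∫⁻ θ, q θ j y * πkx k θ * h j ∂τ ∂μ := by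
          refine lintegral_congr fun j => ?_
          have hqπ_meas : Measurable (fun θ => q θ j y * πkx k θ) := (hqj j).mul (hπk k)
          rw [hqπjk, lintegral_mul_const _ hqπ_meas]
      _ = ∫⁻ θ, ∫⁻ j, q θ j y * πkx k θ * h j ∂μ ∂τ := by
          refine lintegral_lintegral_swap (Measurable.aemeasurable ?_)
          exact ((hqy.mul ((hπk k).comp measurable_fst)).mul
            (hhmeas.comp measurable_snd)).comp measurable_swap
      _ = ∫⁻ θ, Q θ * πkx k θ ∂τ := by
          refine lintegral_congr fun θ => ?_
          have hqh : Measurable (fun j => q θ j y * h j) := (hqθ θ).mul hhmeas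
          simp only [hQ, ← lintegral_mul_const _ hqh, mul_right_comm _ (πkx k θ)]
  have hbayes : ∀ᵐ k ∂μ, ∀ θ, πkx k θ * gπx k = π θ * (f θ k x * g k) / Z := by
    filter_upwards [hmae] with k hk θ
    rw [hπkx, hgπx]
    rcases eq_or_ne (g k) 0 with h0 | h0
    · simp [h0]
    · obtain ⟨hm0, hmtop⟩ := hk (pos_iff_ne_zero.mpr h0)
      calc π θ * f θ k x / m k * (g k * m k / Z)
          = π θ * (f θ k x * g k) / Z * (m k * (m k)⁻¹) := by
            simp only [div_eq_mul_inv]; ring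
        _ = π θ * (f θ k x * g k) / Z := by
            rw [ENNReal.mul_inv_cancel hm0.ne' hmtop.ne, mul_one]
  symm
  calc ∫⁻ k, (∫⁻ j, qπjk j k y * h j ∂μ) * gπx k ∂μ
      = ∫⁻ k, ∫⁻ θ, Q θ * (π θ * (f θ k x * g k) / Z) ∂τ ∂μ := by
        refine lintegral_congr_ae ?_
        filter_upwards [hbayes] with k hk
        have hQπ : Measurable (fun θ => Q θ * πkx k θ) := hQmeas.mul (hπk k)
        rw [hcond, ← lintegral_mul_const _ hQπ]
        simp only [mul_assoc (Q _), hk]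
    _ = ∫⁻ θ, ∫⁻ k, Q θ * (π θ * (f θ k x * g k) / Z) ∂μ ∂τ := by
        refine lintegral_lintegral_swap (Measurable.aemeasurable ?_)
        exact ((hQmeas.comp measurable_fst).mul (((hπmeas.comp measurable_fst).mul
          (hfx.mul (hgmeas.comp measurable_snd))).div_const Z)).comp measurable_swap
    _ = qπ y := by
        rw [hqπ]
        refine lintegral_congr fun θ => ?_
        have hfg : Measurable (fun k => f θ k x * g k) := (hfθ θ).mul hgmeas
        rw [hpost, lintegral_const_mul _ ((hfg.const_mul (π θ)).div_const Z)]
        simp only [div_eq_mul_inv]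
        rw [lintegral_mul_const _ (hfg.const_mul (π θ)), lintegral_const_mul _ hfg]
end

section
/- Let ν₁, ν₂, a₁, a₂, b₁, b₂ > 0 and x₁, x₂ > 0, and let G be a probability measure on [0,∞). For α, β > 0 let γ(α,β)(t) = β^α t^{α-1} e^{-βt}/Γ(α) for t > 0 denote the Gamma G(α,β) density. Define the model density p(x₁,x₂ | θ₁,θ₂) = ∫ γ(ν₁+k, θ₁)(x₁) γ(ν₂+k, θ₂)(x₂) dG(k) for θ₁, θ₂ > 0, the prior density π(θ₁,θ₂) = γ(a₁,b₁)(θ₁) γ(a₂,b₂)(θ₂), and ρ(k) = [Γ(ν₁+a₁+k) Γ(ν₂+a₂+k)/(Γ(ν₁+k) Γ(ν₂+k))] · (x₁x₂/((b₁+x₁)(b₂+x₂)))^k; assume 0 < ∫ ρ dG < ∞. Then the posterior density π(θ₁,θ₂ | x₁,x₂) := π(θ₁,θ₂) p(x₁,x₂|θ₁,θ₂) / ∫∫ π p dθ₁ dθ₂ satisfies, for all θ₁, θ₂ > 0, π(θ₁,θ₂ | x₁,x₂) = ∫ γ(a₁+ν₁+k, b₁+x₁)(θ₁) γ(a₂+ν₂+k,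 b₂+x₂)(θ₂) · (ρ(k)/∫ρ dG) dG(k). -/
open MeasureTheory

lemma Real.measurable_Gamma : Measurable Real.Gamma := by
  have h : Measurable fun s : ℂ => (Complex.Gamma s)⁻¹ :=
    Complex.differentiable_one_div_Gamma.continuous.measurable
  have h' : Measurable Complex.Gamma := by
    convert! h.inv using 1
    ext s
    simp
  exact Complex.measurable_re.comp (h'.comp Complex.measurable_ofReal)

/-- Integrating a mixture of products of probability densities gives the total mixing mass. -/
lemma integral_integral_mixture {α β κ : Type*} [MeasurableSpace α] [MeasurableSpace β]
    [MeasurableSpace κ] {μ : Measure α} {ν : Measure β} {G : Measure κ} [SFinite μ] [SFinite ν]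
    [SFinite G] {f : κ → α → ℝ} {g : κ → β → ℝ} {w : κ → ℝ}
    (hfm : Measurable (Function.uncurry f)) (hgm : Measurable (Function.uncurry g))
    (hw : Integrable w G)
    (hf0 : ∀ᵐ k ∂G, 0 ≤ᵐ[μ] f k) (hg0 : ∀ᵐ k ∂G, 0 ≤ᵐ[ν] g k)
    (hf : ∀ᵐ k ∂G, ∫ s, f k s ∂μ = 1) (hg : ∀ᵐ k ∂G, ∫ t, g k t ∂ν = 1) :
    ∫ s, ∫ t, ∫ k, f k s * g k t * w k ∂G ∂ν ∂μ = ∫ k, w k ∂G := by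
  have hint : Integrable (fun z : (α × β) × κ => f z.2 z.1.1 * g z.2 z.1.2 * w z.2)
      ((μ.prod ν).prod G) := by
    have hm : AEStronglyMeasurable (fun z : (α × β) × κ => f z.2 z.1.1 * g z.2 z.1.2 * w z.2)
        ((μ.prod ν).prod G) := by
      refine AEStronglyMeasurable.mul (Measurable.aestronglyMeasurable ?_)
        hw.aestronglyMeasurable.comp_snd
      exact (hfm.comp (f := fun z : (α × β) × κ => (z.2, z.1.1)) (by fun_prop)).mul
        (hgm.comp (f := fun z : (α × β) × κ => (z.2, z.1.2)) (by fun_prop))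
    rw [integrable_prod_iff' hm]
    constructor
    · filter_upwards [hf, hg] with k hfk hgk
      exact ((Integrable.of_integral_ne_zero (by simp [hfk])).mul_prod
        (Integrable.of_integral_ne_zero (by simp [hgk]))).mul_const (w k)
    · refine hw.norm.congr ?_
      filter_upwards [hf, hg, hf0, hg0] with k hfk hgk hfk0 hgk0
      have hfn : ∫ s, ‖f k s‖ ∂μ = 1 := by
        rw [← hfk]
        exact integral_congr_ae (hfk0.mono fun s hs => Real.norm_of_nonneg hs)
      have hgn : ∫ t, ‖g k t‖ ∂ν = 1 := by
        rw [← hgk]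
        exact integral_congr_ae (hgk0.mono fun t ht => Real.norm_of_nonneg ht)
      simp only [norm_mul]
      rw [integral_mul_const, integral_prod_mul (fun s => ‖f k s‖) (fun t => ‖g k t‖), hfn, hgn]
      simp
  rw [← integral_prod (fun z : α × β => ∫ k, f k z.1 * g k z.2 * w k ∂G) hint.integral_prod_left,
    integral_integral_swap (f := fun (z : α × β) k => f k z.1 * g k z.2 * w k) hint]
  refine integral_congr_ae ?_
  filter_upwards [hf, hg] with k hfk hgk
  rw [integral_mul_const, integral_prod_mul (f k) (g k), hfk, hgk]
  simp

/-- The density of the Gamma distribution with shape `α` and rate `β`, without truncation to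
positive arguments. -/
noncomputable def gammaDensity (α β t : ℝ) : ℝ :=
  β ^ α * t ^ (α - 1) * Real.exp (-(β * t)) / Real.Gamma α

lemma integral_gammaDensity {α β : ℝ} (hα : 0 < α) (hβ : 0 < β) :
    ∫ t in Set.Ioi 0, gammaDensity α β t = 1 := by
  have h : ∀ t, gammaDensity α β t =
      β ^ α / Real.Gamma α * (t ^ (α - 1) * Real.exp (-(β * t))) := fun t => by
    unfold gammaDensity; ring
  have := (Real.Gamma_pos_of_pos hα).ne'
  have := (Real.rpow_pos_of_pos hβ α).ne'
  simp_rw [h]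
  rw [integral_const_mul, Real.integral_rpow_mul_exp_neg_mul_Ioi hα hβ,
    Real.div_rpow zero_le_one hβ.le, Real.one_rpow]
  field_simp

lemma gammaDensity_nonneg {α β t : ℝ} (hα : 0 < α) (hβ : 0 < β) (ht : 0 < t) :
    0 ≤ gammaDensity α β t := by
  have := Real.Gamma_pos_of_pos hα
  unfold gammaDensity
  positivity

lemma measurable_gammaDensity_shape_add (α β : ℝ) :
    Measurable (Function.uncurry fun k t => gammaDensity (α + k) β t) := by
  have := Real.measurable_Gamma
  unfold gammaDensity Function.uncurry
  fun_prop

/-- Conjugacy of the Gamma prior on the rate of a Gamma likelihood. -/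
lemma gammaDensity_mul_gammaDensity {ν a b x k t : ℝ} (hν : 0 < ν) (ha : 0 < a) (hb : 0 < b)
    (hx : 0 < x) (hk : 0 ≤ k) (ht : 0 < t) :
    gammaDensity a b t * gammaDensity (ν + k) t x =
      b ^ a * x ^ (ν - 1) / (Real.Gamma a * (b + x) ^ (a + ν)) *
        (gammaDensity (a + ν + k) (b + x) t *
          (Real.Gamma (ν + a + k) / Real.Gamma (ν + k) * (x / (b + x)) ^ k)) := by
  have hbx : 0 < b + x := by positivity
  have h₁ := (Real.Gamma_pos_of_pos ha).ne'
  have h₂ := (Real.Gamma_pos_of_pos (by positivity : 0 < ν + k)).ne'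
  have h₃ := (Real.Gamma_pos_of_pos (by positivity : 0 < a + ν + k)).ne'
  have h₄ := (Real.rpow_pos_of_pos hbx (a + ν)).ne'
  have h₅ := (Real.rpow_pos_of_pos hbx k).ne'
  have hx' : x ^ (ν + k - 1) = x ^ (ν - 1) * x ^ k := by
    rw [← Real.rpow_add hx]; ring_nf
  have ht' : t ^ (a + ν + k - 1) = t ^ (a - 1) * t ^ (ν + k) := by
    rw [← Real.rpow_add ht]; ring_nf
  have he : Real.exp (-((b + x) * t)) = Real.exp (-(b * t)) * Real.exp (-(t * x)) := by
    rw [← Real.exp_add]; ring_nf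
  unfold gammaDensity
  rw [hx', ht', he, Real.rpow_add hbx (a + ν) k, Real.div_rpow hx.le hbx.le, add_comm ν a]
  field_simp

/-- Corollary 4.1(a): the posterior for a Kibble-type bivariate gamma mixture model with
independent Gamma priors is the G2(ν₁+a₁, ν₂+a₂, b₁+x₁, b₂+x₂, G_{π,x}) distribution,
where dG_{π,x}/dG ∝ ρ. -/
theorem kibble_type_posterior
    (ν₁ ν₂ a₁ a₂ b₁ b₂ x₁ x₂ : ℝ)
    (hν₁ : 0 < ν₁) (hν₂ : 0 < ν₂) (ha₁ : 0 < a₁) (ha₂ : 0 < a₂)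
    (hb₁ : 0 < b₁) (hb₂ : 0 < b₂) (hx₁ : 0 < x₁) (hx₂ : 0 < x₂)
    (G : Measure ℝ) [IsProbabilityMeasure G] (hG : G (Set.Iio 0) = 0)
    (gam : ℝ → ℝ → ℝ → ℝ)
    (hgam : ∀ α β t, gam α β t = β ^ α * t ^ (α - 1) * Real.exp (-(β * t)) / Real.Gamma α)
    (p : ℝ → ℝ → ℝ)
    (hp : ∀ θ₁ θ₂, p θ₁ θ₂ = ∫ k, gam (ν₁ + k) θ₁ x₁ * gam (ν₂ + k) θ₂ x₂ ∂G)
    (pri : ℝ → ℝ → ℝ)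
    (hpri : ∀ θ₁ θ₂, pri θ₁ θ₂ = gam a₁ b₁ θ₁ * gam a₂ b₂ θ₂)
    (ρ : ℝ → ℝ)
    (hρ : ∀ k, ρ k =
      (Real.Gamma (ν₁ + a₁ + k) * Real.Gamma (ν₂ + a₂ + k) /
        (Real.Gamma (ν₁ + k) * Real.Gamma (ν₂ + k))) *
      (x₁ * x₂ / ((b₁ + x₁) * (b₂ + x₂))) ^ k)
    (hρint : Integrable ρ G) (hρpos : 0 < ∫ k, ρ k ∂G) :
    ∀ θ₁ θ₂ : ℝ, 0 < θ₁ → 0 < θ₂ →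
      pri θ₁ θ₂ * p θ₁ θ₂ /
          (∫ t₁ in Set.Ioi (0 : ℝ), ∫ t₂ in Set.Ioi (0 : ℝ), pri t₁ t₂ * p t₁ t₂) =
        ∫ k, gam (a₁ + ν₁ + k) (b₁ + x₁) θ₁ * gam (a₂ + ν₂ + k) (b₂ + x₂) θ₂ *
          (ρ k / ∫ j, ρ j ∂G) ∂G := by
  obtain rfl : gam = gammaDensity := by
    funext α β t
    exact hgam α β t
  have hG0 : ∀ᵐ k ∂G, 0 ≤ k := by
    simp only [ae_iff, not_le]
    exact hG
  set C : ℝ := b₁ ^ a₁ * x₁ ^ (ν₁ - 1) / (Real.Gamma a₁ * (b₁ + x₁) ^ (a₁ + ν₁)) *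
    (b₂ ^ a₂ * x₂ ^ (ν₂ - 1) / (Real.Gamma a₂ * (b₂ + x₂) ^ (a₂ + ν₂))) with hC
  have hC0 : C ≠ 0 := by
    have := Real.Gamma_pos_of_pos ha₁
    have := Real.Gamma_pos_of_pos ha₂
    positivity
  have hjoint : ∀ t₁ t₂ : ℝ, 0 < t₁ → 0 < t₂ → pri t₁ t₂ * p t₁ t₂ =
      C * ∫ k, gammaDensity (a₁ + ν₁ + k) (b₁ + x₁) t₁ *
        gammaDensity (a₂ + ν₂ + k) (b₂ + x₂) t₂ * ρ k ∂G := by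
    intro t₁ t₂ ht₁ ht₂
    rw [hpri, hp, ← integral_const_mul, ← integral_const_mul]
    refine integral_congr_ae ?_
    filter_upwards [hG0] with k hk
    rw [mul_mul_mul_comm, gammaDensity_mul_gammaDensity hν₁ ha₁ hb₁ hx₁ hk ht₁,
      gammaDensity_mul_gammaDensity hν₂ ha₂ hb₂ hx₂ hk ht₂, hρ, hC, mul_div_mul_comm x₁,
      Real.mul_rpow (by positivity) (by positivity)]
    ring
  have hnorm : ∫ t₁ in Set.Ioi (0 : ℝ), ∫ t₂ in Set.Ioi (0 : ℝ), pri t₁ t₂ * p t₁ t₂ =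
      C * ∫ k, ρ k ∂G := by
    have hnonneg : ∀ {a ν β : ℝ}, 0 < a → 0 < ν → 0 < β → ∀ᵐ k ∂G,
        0 ≤ᵐ[volume.restrict (Set.Ioi 0)] gammaDensity (a + ν + k) β := fun ha hν hβ => by
      filter_upwards [hG0] with k hk
      filter_upwards [ae_restrict_mem measurableSet_Ioi] with t ht
      exact gammaDensity_nonneg (by positivity) hβ ht
    have hone : ∀ {a ν β : ℝ}, 0 < a → 0 < ν → 0 < β → ∀ᵐ k ∂G,
        ∫ t in Set.Ioi 0, gammaDensity (a + ν + k) β t = 1 := fun ha hν hβ => by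
      filter_upwards [hG0] with k hk
      exact integral_gammaDensity (by positivity) hβ
    rw [← integral_integral_mixture (measurable_gammaDensity_shape_add (a₁ + ν₁) (b₁ + x₁))
      (measurable_gammaDensity_shape_add (a₂ + ν₂) (b₂ + x₂)) hρint
      (hnonneg ha₁ hν₁ (by positivity)) (hnonneg ha₂ hν₂ (by positivity))
      (hone ha₁ hν₁ (by positivity)) (hone ha₂ hν₂ (by positivity)), ← integral_const_mul]
    refine setIntegral_congr_fun measurableSet_Ioi fun t₁ ht₁ => ?_
    rw [← integral_const_mul]
    exact setIntegral_congr_fun measurableSet_Ioi fun t₂ ht₂ => hjoint t₁ t₂ ht₁ ht₂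
  intro θ₁ θ₂ hθ₁ hθ₂
  simp_rw [← mul_div_assoc]
  rw [hjoint θ₁ θ₂ hθ₁ hθ₂, hnorm, mul_div_mul_left _ _ hC0, integral_div]
end

section
/- Let ν₁, ν₂, ν₁', ν₂', a₁, a₂, b₁, b₂ > 0 and x₁, x₂ > 0, let G and H be probability measures on [0,∞), and let γ(α,β)(t) = β^α t^{α-1} e^{-βt}/Γ(α) denote the Gamma G(α,β) density and B2(α,β,σ)(t) = Γ(α+β) σ^β t^{α-1}/(Γ(α) Γ(β) (σ+t)^{α+β}) for t > 0 denote the Beta type II density. Define ρ(k) = [Γ(ν₁+a₁+k) Γ(ν₂+a₂+k)/(Γ(ν₁+k) Γ(ν₂+k))] · (x₁x₂/((b₁+x₁)(b₂+x₂)))^k and assume 0 < ∫ ρ dG < ∞. With the posterior π(θ₁,θ₂|x₁,x₂) for the model p(x|θ) = ∫ γ(ν₁+k,θ₁)(x₁) γ(ν₂+k,θ₂)(x₂) dG(k) and prior γ(a₁,b₁)(θ₁) γ(a₂,b₂)(θ₂), the Bayes predictive density of Y = (Y₁,Y₂), namely q_π(y₁,y₂|x₁,x₂) := ∫₀^∞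 ∫₀^∞ [∫ γ(ν₁'+j,θ₁)(y₁) γ(ν₂'+j,θ₂)(y₂) dH(j)] π(θ₁,θ₂|x₁,x₂) dθ₁ dθ₂, satisfies for all y₁, y₂ > 0: q_π(y₁,y₂|x₁,x₂) = ∫∫ B2(ν₁'+j, a₁+ν₁+k, b₁+x₁)(y₁) · B2(ν₂'+j, a₂+ν₂+k, b₂+x₂)(y₂) dH(j) · (ρ(k)/∫ρ dG) dG(k). -/
open MeasureTheory

namespace GammaMixture

/-- The Gamma density with shape `α` and rate `β`. -/
noncomputable def gammaDensity (α β t : ℝ) : ℝ :=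
  β ^ α * t ^ (α - 1) * Real.exp (-(β * t)) / Real.Gamma α

/-- The Beta type II density with shapes `α`, `β` and scale `σ`. -/
noncomputable def betaTwoDensity (α β σ t : ℝ) : ℝ :=
  Real.Gamma (α + β) * σ ^ β * t ^ (α - 1) /
    (Real.Gamma α * Real.Gamma β * (σ + t) ^ (α + β))

theorem measurable_Gamma : Measurable Real.Gamma := by
  classical
  let s : Set ℝ := Set.range fun n : ℕ => -(n : ℝ)
  have hs : MeasurableSet s := (Set.countable_range _).measurableSet
  have hc : ContinuousOn Real.Gamma sᶜ := fun t ht =>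
    (Real.differentiableAt_Gamma fun m hm => ht ⟨m, hm.symm⟩).continuousAt.continuousWithinAt
  have h : s.piecewise (fun _ => 0) Real.Gamma = Real.Gamma := by
    ext t
    by_cases ht : t ∈ s
    · rw [Set.piecewise_eq_of_mem _ _ _ ht]
      obtain ⟨n, rfl⟩ := ht
      exact (Real.Gamma_neg_nat_eq_zero n).symm
    · rw [Set.piecewise_eq_of_notMem _ _ _ ht]
  rw [← h]
  exact continuousOn_const.measurable_piecewise hc hs

theorem measurable_gammaDensity {ι : Type*} [MeasurableSpace ι] {f g h : ι → ℝ}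
    (hf : Measurable f) (hg : Measurable g) (hh : Measurable h) :
    Measurable fun i => gammaDensity (f i) (g i) (h i) := by
  unfold gammaDensity
  exact (((hg.pow hf).mul (hh.pow (hf.sub_const 1))).mul
    (hg.mul hh).neg.exp).div (measurable_Gamma.comp hf)

theorem gammaDensity_nonneg {α β t : ℝ} (hα : 0 < α) (hβ : 0 ≤ β) (ht : 0 ≤ t) :
    0 ≤ gammaDensity α β t := by
  have := Real.Gamma_pos_of_pos hα
  unfold gammaDensity
  positivity

theorem rpow_mul_exp_neg_le_Gamma {α l : ℝ} (hα : 0 < α) (hl : 0 < l) :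
    l ^ α * Real.exp (-l) ≤ Real.exp 1 * (l + 1) * Real.Gamma α := by
  have hint := Real.GammaIntegral_convergent hα
  have hsub : Set.Ioc l (l + 1) ⊆ Set.Ioi 0 := fun t ht => hl.trans ht.1
  have h₁ : l ^ α * Real.exp (-l) / (Real.exp 1 * (l + 1)) ≤
      ∫ t in Set.Ioc l (l + 1), Real.exp (-t) * t ^ (α - 1) := by
    have := setIntegral_ge_of_const_le_real (μ := volume)
      (c := l ^ α * Real.exp (-l) / (Real.exp 1 * (l + 1)))
      (f := fun t => Real.exp (-t) * t ^ (α - 1)) (measurableSet_Ioc (a := l) (b := l + 1))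
      (by simp) ?_ (hint.mono_set hsub)
    · simpa using this
    · intro t ht
      have ht0 : 0 < t := hl.trans ht.1
      have he : Real.exp (-l) / Real.exp 1 ≤ Real.exp (-t) := by
        rw [← Real.exp_sub]
        exact Real.exp_le_exp.2 (by linarith [ht.2])
      have hp : l ^ α / (l + 1) ≤ t ^ (α - 1) := by
        rw [Real.rpow_sub_one ht0.ne']
        exact div_le_div₀ (by positivity) (Real.rpow_le_rpow hl.le ht.1.le hα.le) ht0 ht.2
      calc _ = Real.exp (-l) / Real.exp 1 * (l ^ α / (l + 1)) := by field_simp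
        _ ≤ _ := mul_le_mul he hp (by positivity) (by positivity)
  have h₂ : ∫ t in Set.Ioc l (l + 1), Real.exp (-t) * t ^ (α - 1) ≤ Real.Gamma α := by
    rw [Real.Gamma_eq_integral hα]
    refine setIntegral_mono_set hint ?_ hsub.eventuallyLE
    filter_upwards [ae_restrict_mem measurableSet_Ioi] with t ht
    have : (0 : ℝ) < t := ht
    simp only [Pi.zero_apply]
    positivity
  have := h₁.trans h₂
  rwa [div_le_iff₀ (by positivity), mul_comm (Real.Gamma α)] at this

/-- A bound on the Gamma density that is uniform in the shape. -/
theorem gammaDensity_le {α t x : ℝ} (hα : 0 < α) (ht : 0 < t) (hx : 0 < x) :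
    gammaDensity α t x ≤ Real.exp 1 * (t + 1 / x) := by
  have h := rpow_mul_exp_neg_le_Gamma hα (mul_pos ht hx)
  rw [Real.mul_rpow ht.le hx.le] at h
  unfold gammaDensity
  rw [div_le_iff₀ (Real.Gamma_pos_of_pos hα), Real.rpow_sub_one hx.ne']
  calc _ = t ^ α * x ^ α * Real.exp (-(t * x)) / x := by ring
    _ ≤ Real.exp 1 * (t * x + 1) * Real.Gamma α / x := by gcongr
    _ = _ := by field_simp

theorem integrableOn_rpow_mul_exp_neg_mul {s b : ℝ} (hs : -1 < s) (hb : 0 < b) :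
    IntegrableOn (fun t : ℝ => t ^ s * Real.exp (-(b * t))) (Set.Ioi 0) := by
  simpa using integrableOn_rpow_mul_exp_neg_mul_rpow hs one_pos hb

theorem integrableOn_mul_gammaDensity {a b : ℝ} (ha : 0 < a) (hb : 0 < b) (c₀ c₁ c₂ : ℝ) :
    IntegrableOn (fun t => (c₀ + c₁ * t + c₂ * t ^ 2) * gammaDensity a b t) (Set.Ioi 0) := by
  have h₀ := (integrableOn_rpow_mul_exp_neg_mul (s := a - 1) (by linarith) hb).const_mul c₀
  have h₁ := (integrableOn_rpow_mul_exp_neg_mul (s := a) (by linarith) hb).const_mul c₁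
  have h₂ := (integrableOn_rpow_mul_exp_neg_mul (s := a + 1) (by linarith) hb).const_mul c₂
  refine IntegrableOn.congr_fun (((h₀.add h₁).add h₂).const_mul (b ^ a / Real.Gamma a)) ?_
    measurableSet_Ioi
  intro t ht
  have ht : (0 : ℝ) < t := ht
  simp only [Pi.add_apply, gammaDensity, Real.rpow_sub_one ht.ne', Real.rpow_add_one ht.ne']
  field_simp

theorem integral_gammaDensity {a b : ℝ} (ha : 0 < a) (hb : 0 < b) :
    ∫ t in Set.Ioi 0, gammaDensity a b t = 1 := by
  have hG := (Real.Gamma_pos_of_pos ha).ne'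
  have h : ∀ t, gammaDensity a b t =
      b ^ a / Real.Gamma a * (t ^ (a - 1) * Real.exp (-(b * t))) := fun t => by
    unfold gammaDensity
    ring
  simp_rw [h]
  rw [integral_const_mul, Real.integral_rpow_mul_exp_neg_mul_Ioi ha hb,
    Real.div_rpow zero_le_one hb.le, Real.one_rpow]
  field_simp

/-- Conjugacy of the Gamma prior for the rate of a Gamma density. -/
theorem gammaDensity_mul_gammaDensity {α a b x t : ℝ} (hα : 0 < α) (ha : 0 < a) (hb : 0 < b)
    (hx : 0 < x) (ht : 0 < t) :
    gammaDensity α t x * gammaDensity a b t =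
      betaTwoDensity α a b x * gammaDensity (a + α) (b + x) t := by
  have h₁ := (Real.Gamma_pos_of_pos hα).ne'
  have h₂ := (Real.Gamma_pos_of_pos ha).ne'
  have h₃ := (Real.Gamma_pos_of_pos (add_pos ha hα)).ne'
  have h₄ := (Real.rpow_pos_of_pos (add_pos hb hx) (a + α)).ne'
  have he : Real.exp (-((b + x) * t)) = Real.exp (-(t * x)) * Real.exp (-(b * t)) := by
    rw [← Real.exp_add]
    ring_nf
  have hp : t ^ (a + α - 1) = t ^ α * t ^ (a - 1) := by
    rw [← Real.rpow_add ht]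
    ring_nf
  simp only [gammaDensity, betaTwoDensity, he, hp, add_comm α a]
  field_simp

theorem integral_gammaDensity_mul {α a b x : ℝ} (hα : 0 < α) (ha : 0 < a) (hb : 0 < b)
    (hx : 0 < x) :
    ∫ t in Set.Ioi 0, gammaDensity α t x * gammaDensity a b t = betaTwoDensity α a b x := by
  rw [setIntegral_congr_fun measurableSet_Ioi fun t ht =>
      gammaDensity_mul_gammaDensity hα ha hb hx ht,
    integral_const_mul, integral_gammaDensity (by positivity) (by positivity), mul_one]

theorem integral_gammaDensity_mul_mul {α β a b x y : ℝ} (hα : 0 < α) (hβ : 0 < β) (ha : 0 < a)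
    (hb : 0 < b) (hx : 0 < x) (hy : 0 < y) :
    ∫ t in Set.Ioi 0, gammaDensity α t y * (gammaDensity β t x * gammaDensity a b t) =
      betaTwoDensity α (a + β) (b + x) y * betaTwoDensity β a b x := by
  have h : ∀ t ∈ Set.Ioi (0 : ℝ),
      gammaDensity α t y * (gammaDensity β t x * gammaDensity a b t) =
        betaTwoDensity β a b x *
          (gammaDensity α t y * gammaDensity (a + β) (b + x) t) := fun t ht => by
    rw [gammaDensity_mul_gammaDensity hβ ha hb hx ht]
    ring
  rw [setIntegral_congr_fun measurableSet_Ioi h, integral_const_mul,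
    integral_gammaDensity_mul hα (by positivity) (by positivity) hy, mul_comm]

/-- The Beta type II density at a fixed point as a function of a shift of its first shape. -/
theorem betaTwoDensity_add {ν k a b x : ℝ} (hb : 0 < b) (hx : 0 < x) :
    betaTwoDensity (ν + k) a b x =
      b ^ a * x ^ (ν - 1) / (Real.Gamma a * (b + x) ^ (ν + a)) *
        (Real.Gamma (ν + a + k) / Real.Gamma (ν + k) * (x / (b + x)) ^ k) := by
  have hbx : 0 < b + x := by positivity
  have h₁ : x ^ (ν + k - 1) = x ^ (ν - 1) * x ^ k := by
    rw [← Real.rpow_add hx]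
    ring_nf
  have h₂ : (b + x) ^ (ν + k + a) = (b + x) ^ (ν + a) * (b + x) ^ k := by
    rw [← Real.rpow_add hbx]
    ring_nf
  rw [betaTwoDensity, h₁, h₂, Real.div_rpow hx.le hbx.le, add_right_comm ν k a]
  simp only [div_eq_mul_inv, mul_inv]
  ring

section Fubini

variable {K T : Type*} [MeasurableSpace K] [MeasurableSpace T] {μ : Measure K}
  {τ : Measure T} [SFinite τ] {A : Set K} {B : Set T} {u v : K → T → ℝ} {g h : T → ℝ}

theorem integrable_mul_of_dominated [IsFiniteMeasure μ] (hA : ∀ᵐ k ∂μ, k ∈ A)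
    (hB : ∀ᵐ t ∂τ, t ∈ B)
    (hu : Measurable (Function.uncurry u)) (hv : Measurable (Function.uncurry v))
    (hg : Integrable g τ) (hh : Integrable h τ)
    (hug : ∀ k ∈ A, ∀ t ∈ B, |u k t| ≤ g t) (hvh : ∀ k ∈ A, ∀ t ∈ B, |v k t| ≤ h t) :
    Integrable (fun z : K × T × T => u z.1 z.2.1 * v z.1 z.2.2) (μ.prod (τ.prod τ)) := by
  refine ((hg.mul_prod hh).comp_snd μ).mono' ?_ ?_
  · exact ((hu.comp (measurable_fst.prodMk measurable_snd.fst)).mul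
      (hv.comp (measurable_fst.prodMk measurable_snd.snd))).aestronglyMeasurable
  · have h₁ := (Measure.quasiMeasurePreserving_fst (μ := μ) (ν := τ.prod τ)).ae hA
    have h₂ := (Measure.quasiMeasurePreserving_snd (μ := μ) (ν := τ.prod τ)).ae
      ((Measure.quasiMeasurePreserving_fst (μ := τ) (ν := τ)).ae hB)
    have h₃ := (Measure.quasiMeasurePreserving_snd (μ := μ) (ν := τ.prod τ)).ae
      ((Measure.quasiMeasurePreserving_snd (μ := τ) (ν := τ)).ae hB)
    filter_upwards [h₁, h₂, h₃] with z h₁ h₂ h₃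
    rw [norm_mul]
    exact mul_le_mul (hug _ h₁ _ h₂) (hvh _ h₁ _ h₃) (norm_nonneg _)
      ((abs_nonneg _).trans (hug _ h₁ _ h₂))

theorem integrable_integral_mul_integral
    (hF : Integrable (fun z : K × T × T => u z.1 z.2.1 * v z.1 z.2.2) (μ.prod (τ.prod τ))) :
    Integrable (fun k => (∫ t, u k t ∂τ) * ∫ t, v k t ∂τ) μ := by
  simpa only [integral_prod_mul] using hF.integral_prod_left

theorem integral_integral_integral_mul [SFinite μ]
    (hF : Integrable (fun z : K × T × T => u z.1 z.2.1 * v z.1 z.2.2) (μ.prod (τ.prod τ))) :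
    ∫ t₁, ∫ t₂, ∫ k, u k t₁ * v k t₂ ∂μ ∂τ ∂τ = ∫ k, (∫ t, u k t ∂τ) * ∫ t, v k t ∂τ ∂μ := by
  have h₁ := integral_prod _ hF.integral_prod_right
  rw [← h₁, ← integral_integral_swap hF]
  simp only [integral_prod_mul]

end Fubini

theorem abs_gammaDensity_mul_le {α a b x t : ℝ} (hα : 0 < α) (ha : 0 < a) (hb : 0 < b)
    (hx : 0 < x) (ht : 0 < t) :
    |gammaDensity α t x * gammaDensity a b t| ≤
      (Real.exp 1 / x + Real.exp 1 * t + 0 * t ^ 2) * gammaDensity a b t := by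
  have h₀ := gammaDensity_nonneg hα ht.le hx.le
  have h₁ := gammaDensity_nonneg ha hb.le ht.le
  rw [abs_of_nonneg (mul_nonneg h₀ h₁)]
  refine mul_le_mul_of_nonneg_right ((gammaDensity_le hα ht hx).trans_eq ?_) h₁
  ring

theorem abs_gammaDensity_mul_mul_le {α β a b x y t : ℝ} (hα : 0 < α) (hβ : 0 < β) (ha : 0 < a)
    (hb : 0 < b) (hx : 0 < x) (hy : 0 < y) (ht : 0 < t) :
    |gammaDensity α t y * (gammaDensity β t x * gammaDensity a b t)| ≤
      (Real.exp 1 ^ 2 / (x * y) + Real.exp 1 ^ 2 * (1 / x + 1 / y) * t + Real.exp 1 ^ 2 * t ^ 2) *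
        gammaDensity a b t := by
  have h₀ := gammaDensity_nonneg hα ht.le hy.le
  have h₁ := gammaDensity_nonneg hβ ht.le hx.le
  have h₂ := gammaDensity_nonneg ha hb.le ht.le
  rw [← mul_assoc, abs_of_nonneg (mul_nonneg (mul_nonneg h₀ h₁) h₂)]
  refine mul_le_mul_of_nonneg_right ((mul_le_mul (gammaDensity_le hα ht hy)
    (gammaDensity_le hβ ht hx) h₁ (by positivity)).trans_eq ?_) h₂
  simp only [div_eq_mul_inv, mul_inv]
  ring

section Mixture

variable {ν₁ ν₂ ν₁' ν₂' a₁ a₂ b₁ b₂ x₁ x₂ y₁ y₂ : ℝ} {G H : Measure ℝ}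
  [IsFiniteMeasure G] [IsFiniteMeasure H]

theorem integral_prior_mul_likelihood
    (hν₁ : 0 < ν₁) (hν₂ : 0 < ν₂) (ha₁ : 0 < a₁) (ha₂ : 0 < a₂) (hb₁ : 0 < b₁) (hb₂ : 0 < b₂)
    (hx₁ : 0 < x₁) (hx₂ : 0 < x₂) (hG : ∀ᵐ k ∂G, 0 ≤ k) :
    ∫ t₁ in Set.Ioi (0 : ℝ), ∫ t₂ in Set.Ioi (0 : ℝ),
        gammaDensity a₁ b₁ t₁ * gammaDensity a₂ b₂ t₂ *
          ∫ k, gammaDensity (ν₁ + k) t₁ x₁ * gammaDensity (ν₂ + k) t₂ x₂ ∂G =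
      ∫ k, betaTwoDensity (ν₁ + k) a₁ b₁ x₁ * betaTwoDensity (ν₂ + k) a₂ b₂ x₂ ∂G := by
  have hmeas : ∀ ν a b x : ℝ, Measurable (Function.uncurry fun k t : ℝ =>
      gammaDensity (ν + k) t x * gammaDensity a b t) := fun ν a b x =>
    (measurable_gammaDensity (measurable_fst.const_add ν) measurable_snd measurable_const).mul
      (measurable_gammaDensity measurable_const measurable_const measurable_snd)
  have hF := integrable_mul_of_dominated (μ := G) (τ := volume.restrict (Set.Ioi (0 : ℝ)))
    (A := Set.Ici 0) hG (ae_restrict_mem measurableSet_Ioi)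
    (hmeas ν₁ a₁ b₁ x₁) (hmeas ν₂ a₂ b₂ x₂)
    (integrableOn_mul_gammaDensity ha₁ hb₁ _ _ _) (integrableOn_mul_gammaDensity ha₂ hb₂ _ _ _)
    (fun _ hk _ ht => abs_gammaDensity_mul_le (add_pos_of_pos_of_nonneg hν₁ hk) ha₁ hb₁ hx₁ ht)
    (fun _ hk _ ht => abs_gammaDensity_mul_le (add_pos_of_pos_of_nonneg hν₂ hk) ha₂ hb₂ hx₂ ht)
  have hlhs : ∀ t₁ t₂ : ℝ,
      gammaDensity a₁ b₁ t₁ * gammaDensity a₂ b₂ t₂ *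
          ∫ k, gammaDensity (ν₁ + k) t₁ x₁ * gammaDensity (ν₂ + k) t₂ x₂ ∂G =
        ∫ k, gammaDensity (ν₁ + k) t₁ x₁ * gammaDensity a₁ b₁ t₁ *
          (gammaDensity (ν₂ + k) t₂ x₂ * gammaDensity a₂ b₂ t₂) ∂G := fun t₁ t₂ => by
    rw [← integral_const_mul]
    congr! 2 with k
    ring
  simp only [hlhs]
  rw [integral_integral_integral_mul hF]
  refine integral_congr_ae <| hG.mono fun k hk => ?_
  simp only
  rw [integral_gammaDensity_mul (add_pos_of_pos_of_nonneg hν₁ hk) ha₁ hb₁ hx₁,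
    integral_gammaDensity_mul (add_pos_of_pos_of_nonneg hν₂ hk) ha₂ hb₂ hx₂]

theorem integral_mixture_mul_prior_mul_likelihood
    (hν₁ : 0 < ν₁) (hν₂ : 0 < ν₂) (hν₁' : 0 < ν₁') (hν₂' : 0 < ν₂') (ha₁ : 0 < a₁) (ha₂ : 0 < a₂)
    (hb₁ : 0 < b₁) (hb₂ : 0 < b₂) (hx₁ : 0 < x₁) (hx₂ : 0 < x₂) (hy₁ : 0 < y₁) (hy₂ : 0 < y₂)
    (hG : ∀ᵐ k ∂G, 0 ≤ k) (hH : ∀ᵐ j ∂H, 0 ≤ j) :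
    ∫ t₁ in Set.Ioi (0 : ℝ), ∫ t₂ in Set.Ioi (0 : ℝ),
        (∫ j, gammaDensity (ν₁' + j) t₁ y₁ * gammaDensity (ν₂' + j) t₂ y₂ ∂H) *
          (gammaDensity a₁ b₁ t₁ * gammaDensity a₂ b₂ t₂ *
            ∫ k, gammaDensity (ν₁ + k) t₁ x₁ * gammaDensity (ν₂ + k) t₂ x₂ ∂G) =
      ∫ k, (∫ j, betaTwoDensity (ν₁' + j) (a₁ + ν₁ + k) (b₁ + x₁) y₁ *
          betaTwoDensity (ν₂' + j) (a₂ + ν₂ + k) (b₂ + x₂) y₂ ∂H) *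
        (betaTwoDensity (ν₁ + k) a₁ b₁ x₁ * betaTwoDensity (ν₂ + k) a₂ b₂ x₂) ∂G := by
  have hmeas : ∀ ν' ν a b x y : ℝ, Measurable (Function.uncurry fun (z : ℝ × ℝ) (t : ℝ) =>
      gammaDensity (ν' + z.2) t y * (gammaDensity (ν + z.1) t x * gammaDensity a b t)) :=
    fun ν' ν a b x y =>
    (measurable_gammaDensity (measurable_fst.snd.const_add ν') measurable_snd
      measurable_const).mul
    ((measurable_gammaDensity (measurable_fst.fst.const_add ν) measurable_snd
      measurable_const).mul
      (measurable_gammaDensity measurable_const measurable_const measurable_snd))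
  have hGH : ∀ᵐ z ∂G.prod H, z ∈ Set.Ici (0 : ℝ) ×ˢ Set.Ici (0 : ℝ) := by
    filter_upwards [(Measure.quasiMeasurePreserving_fst (μ := G) (ν := H)).ae hG,
      (Measure.quasiMeasurePreserving_snd (μ := G) (ν := H)).ae hH] with z h₁ h₂
    exact ⟨h₁, h₂⟩
  have hF := integrable_mul_of_dominated (μ := G.prod H)
    (τ := volume.restrict (Set.Ioi (0 : ℝ))) hGH (ae_restrict_mem measurableSet_Ioi)
    (hmeas ν₁' ν₁ a₁ b₁ x₁ y₁) (hmeas ν₂' ν₂ a₂ b₂ x₂ y₂)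
    (integrableOn_mul_gammaDensity ha₁ hb₁ _ _ _) (integrableOn_mul_gammaDensity ha₂ hb₂ _ _ _)
    (fun _ hz _ ht => abs_gammaDensity_mul_mul_le (add_pos_of_pos_of_nonneg hν₁' hz.2)
      (add_pos_of_pos_of_nonneg hν₁ hz.1) ha₁ hb₁ hx₁ hy₁ ht)
    (fun _ hz _ ht => abs_gammaDensity_mul_mul_le (add_pos_of_pos_of_nonneg hν₂' hz.2)
      (add_pos_of_pos_of_nonneg hν₂ hz.1) ha₂ hb₂ hx₂ hy₂ ht)
  have hlhs : ∀ t₁ t₂ : ℝ,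
      (∫ j, gammaDensity (ν₁' + j) t₁ y₁ * gammaDensity (ν₂' + j) t₂ y₂ ∂H) *
          (gammaDensity a₁ b₁ t₁ * gammaDensity a₂ b₂ t₂ *
            ∫ k, gammaDensity (ν₁ + k) t₁ x₁ * gammaDensity (ν₂ + k) t₂ x₂ ∂G) =
        ∫ z : ℝ × ℝ, gammaDensity (ν₁' + z.2) t₁ y₁ *
            (gammaDensity (ν₁ + z.1) t₁ x₁ * gammaDensity a₁ b₁ t₁) *
          (gammaDensity (ν₂' + z.2) t₂ y₂ *
            (gammaDensity (ν₂ + z.1) t₂ x₂ * gammaDensity a₂ b₂ t₂)) ∂G.prod H := fun t₁ t₂ => by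
    rw [← integral_const_mul, mul_comm, ← integral_prod_mul]
    congr! 2 with z
    ring
  simp only [hlhs]
  rw [integral_integral_integral_mul hF, integral_prod _ (integrable_integral_mul_integral hF)]
  refine integral_congr_ae <| hG.mono fun k hk => ?_
  simp only
  rw [← integral_mul_const]
  refine integral_congr_ae <| hH.mono fun j hj => ?_
  have hk : 0 ≤ k := hk
  have hj : 0 ≤ j := hj
  simp only
  rw [integral_gammaDensity_mul_mul (by positivity) (by positivity) ha₁ hb₁ hx₁ hy₁,
    integral_gammaDensity_mul_mul (by positivity) (by positivity) ha₂ hb₂ hx₂ hy₂,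
    ← add_assoc, ← add_assoc]
  ring

end Mixture

end GammaMixture

/-- Corollary 4.1(b): the Bayes predictive density for a Kibble-type bivariate gamma mixture
model with independent Gamma priors is a mixture, over J' ~ H and K' ~ G_{π,x}
(with dG_{π,x}/dG ∝ ρ), of products of Beta type II densities. -/
theorem kibble_type_predictive
    (ν₁ ν₂ ν₁' ν₂' a₁ a₂ b₁ b₂ x₁ x₂ : ℝ)
    (hν₁ : 0 < ν₁) (hν₂ : 0 < ν₂) (hν₁' : 0 < ν₁') (hν₂' : 0 < ν₂')
    (ha₁ : 0 < a₁) (ha₂ : 0 < a₂)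
    (hb₁ : 0 < b₁) (hb₂ : 0 < b₂) (hx₁ : 0 < x₁) (hx₂ : 0 < x₂)
    (G H : Measure ℝ) [IsProbabilityMeasure G] [IsProbabilityMeasure H]
    (hG : G (Set.Iio 0) = 0) (hH : H (Set.Iio 0) = 0)
    (gam : ℝ → ℝ → ℝ → ℝ)
    (hgam : ∀ α β t, gam α β t = β ^ α * t ^ (α - 1) * Real.exp (-(β * t)) / Real.Gamma α)
    (B2 : ℝ → ℝ → ℝ → ℝ → ℝ)
    (hB2 : ∀ α β σ t, B2 α β σ t =
      Real.Gamma (α + β) * σ ^ β * t ^ (α - 1) /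
        (Real.Gamma α * Real.Gamma β * (σ + t) ^ (α + β)))
    (p : ℝ → ℝ → ℝ)
    (hp : ∀ θ₁ θ₂, p θ₁ θ₂ = ∫ k, gam (ν₁ + k) θ₁ x₁ * gam (ν₂ + k) θ₂ x₂ ∂G)
    (pri : ℝ → ℝ → ℝ)
    (hpri : ∀ θ₁ θ₂, pri θ₁ θ₂ = gam a₁ b₁ θ₁ * gam a₂ b₂ θ₂)
    (ρ : ℝ → ℝ)
    (hρ : ∀ k, ρ k =
      (Real.Gamma (ν₁ + a₁ + k) * Real.Gamma (ν₂ + a₂ + k) /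
        (Real.Gamma (ν₁ + k) * Real.Gamma (ν₂ + k))) *
      (x₁ * x₂ / ((b₁ + x₁) * (b₂ + x₂))) ^ k)
    (hρint : Integrable ρ G) (hρpos : 0 < ∫ k, ρ k ∂G)
    (post : ℝ → ℝ → ℝ)
    (hpost : ∀ θ₁ θ₂, post θ₁ θ₂ = pri θ₁ θ₂ * p θ₁ θ₂ /
      (∫ t₁ in Set.Ioi (0 : ℝ), ∫ t₂ in Set.Ioi (0 : ℝ), pri t₁ t₂ * p t₁ t₂))
    (qπ : ℝ → ℝ → ℝ)
    (hqπ : ∀ y₁ y₂, qπ y₁ y₂ =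
      ∫ t₁ in Set.Ioi (0 : ℝ), ∫ t₂ in Set.Ioi (0 : ℝ),
        (∫ j, gam (ν₁' + j) t₁ y₁ * gam (ν₂' + j) t₂ y₂ ∂H) * post t₁ t₂) :
    ∀ y₁ y₂ : ℝ, 0 < y₁ → 0 < y₂ →
      qπ y₁ y₂ =
        ∫ k, (∫ j, B2 (ν₁' + j) (a₁ + ν₁ + k) (b₁ + x₁) y₁ *
              B2 (ν₂' + j) (a₂ + ν₂ + k) (b₂ + x₂) y₂ ∂H) *
          (ρ k / ∫ j, ρ j ∂G) ∂G := by
  intro y₁ y₂ hy₁ hy₂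
  obtain rfl : gam = GammaMixture.gammaDensity := by
    funext α β t
    exact hgam α β t
  obtain rfl : B2 = GammaMixture.betaTwoDensity := by
    funext α β σ t
    exact hB2 α β σ t
  have hG' : ∀ᵐ k ∂G, 0 ≤ k := by
    filter_upwards [measure_eq_zero_iff_ae_notMem.1 hG] with k hk using not_lt.1 hk
  have hH' : ∀ᵐ j ∂H, 0 ≤ j := by
    filter_upwards [measure_eq_zero_iff_ae_notMem.1 hH] with j hj using not_lt.1 hj
  obtain ⟨C, hC, hCρ⟩ : ∃ C : ℝ, 0 < C ∧ ∀ k,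
      GammaMixture.betaTwoDensity (ν₁ + k) a₁ b₁ x₁ *
        GammaMixture.betaTwoDensity (ν₂ + k) a₂ b₂ x₂ = C * ρ k := by
    have h₁ := Real.Gamma_pos_of_pos ha₁
    have h₂ := Real.Gamma_pos_of_pos ha₂
    refine ⟨b₁ ^ a₁ * x₁ ^ (ν₁ - 1) / (Real.Gamma a₁ * (b₁ + x₁) ^ (ν₁ + a₁)) *
      (b₂ ^ a₂ * x₂ ^ (ν₂ - 1) / (Real.Gamma a₂ * (b₂ + x₂) ^ (ν₂ + a₂))), by positivity,
      fun k => ?_⟩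
    rw [hρ, GammaMixture.betaTwoDensity_add hb₁ hx₁, GammaMixture.betaTwoDensity_add hb₂ hx₂,
      mul_div_mul_comm x₁, Real.mul_rpow (by positivity) (by positivity), mul_div_mul_comm
        (Real.Gamma (ν₁ + a₁ + k))]
    ring
  simp only [hqπ, hpost, hpri, hp]
  rw [GammaMixture.integral_prior_mul_likelihood hν₁ hν₂ ha₁ ha₂ hb₁ hb₂ hx₁ hx₂ hG']
  simp only [← mul_div_assoc, integral_div]
  rw [GammaMixture.integral_mixture_mul_prior_mul_likelihood hν₁ hν₂ hν₁' hν₂' ha₁ ha₂ hb₁ hb₂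
    hx₁ hx₂ hy₁ hy₂ hG' hH']
  simp only [hCρ, mul_left_comm _ C, integral_const_mul]
  rw [mul_div_mul_left _ _ hC.ne']
end

section
/- Let p, a, b, x > 0. Suppose the model density of X given θ > 0 is f(x|θ) = Σ_{k=0}^∞ (e^{-θ} θ^k/k!) · (x/2)^{p/2+k-1} e^{-x/2}/(2 Γ(p/2+k)) (the noncentral chi-square χ²_p(2θ) density), and the prior density is π(θ) = b^a θ^{a-1} e^{-bθ}/Γ(a). Then the posterior mean satisfies ∫₀^∞ θ π(θ) f(x|θ) dθ / ∫₀^∞ π(θ) f(x|θ) dθ = (a/(1+b)) · (1 + (x/(p(1+b))) · ₁F₁(a+1; p/2+1; z)/₁F₁(a; p/2; z)), where z = x/(2(1+b)) and ₁F₁(a; c; z) = Σ_{k≥0} (a)_k z^k/((c)_k k!) with (a)_k = Γ(a+k)/Γ(a). -/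
open MeasureTheory

/-- The `k`-th term `(α)_k w ^ k / ((c)_k k!)` of the series of the confluent hypergeometric
function `₁F₁(α; c; w)`, with Pochhammer symbols written as quotients of Gamma values. -/
noncomputable def kummerTerm (α c w : ℝ) (k : ℕ) : ℝ :=
  (Real.Gamma (α + k) / Real.Gamma α) * w ^ k /
    ((Real.Gamma (c + k) / Real.Gamma c) * (Nat.factorial k : ℝ))

theorem kummerTerm_pos {α c w : ℝ} (hα : 0 < α) (hc : 0 < c) (hw : 0 < w) (k : ℕ) :
    0 < kummerTerm α c w k := by
  have h1 := Real.Gamma_pos_of_pos hα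
  have h2 := Real.Gamma_pos_of_pos hc
  have h3 := Real.Gamma_pos_of_pos (show 0 < α + k by positivity)
  have h4 := Real.Gamma_pos_of_pos (show 0 < c + k by positivity)
  unfold kummerTerm
  positivity

theorem kummerTerm_zero {α c : ℝ} (hα : 0 < α) (hc : 0 < c) (w : ℝ) :
    kummerTerm α c w 0 = 1 := by
  have h1 := (Real.Gamma_pos_of_pos hα).ne'
  have h2 := (Real.Gamma_pos_of_pos hc).ne'
  simp [kummerTerm, h1, h2]

theorem kummerTerm_succ {α c : ℝ} (hα : 0 < α) (hc : 0 < c) (w : ℝ) (k : ℕ) :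
    kummerTerm α c w (k + 1) =
      (α + k) / (c + k) * (w / (k + 1)) * kummerTerm α c w k := by
  have hαk : 0 < α + k := by positivity
  have hck : 0 < c + k := by positivity
  have h1 := (Real.Gamma_pos_of_pos hα).ne'
  have h2 := (Real.Gamma_pos_of_pos hc).ne'
  have h3 := (Real.Gamma_pos_of_pos hck).ne'
  unfold kummerTerm
  rw [Nat.factorial_succ, Nat.cast_succ, ← add_assoc, ← add_assoc,
    Real.Gamma_add_one hαk.ne', Real.Gamma_add_one hck.ne']
  push_cast
  field_simp
  ring

theorem summable_kummerTerm {α c w : ℝ} (hα : 0 < α) (hc : 0 < c) (hw : 0 < w) :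
    Summable (kummerTerm α c w) := by
  refine summable_of_ratio_test_tendsto_lt_one (l := 0) one_pos
    (Filter.Eventually.of_forall fun k => (kummerTerm_pos hα hc hw k).ne') ?_
  have h0 : Filter.Tendsto (fun k : ℕ => (1 + α / c) * w * (1 / ((k : ℝ) + 1)))
      Filter.atTop (nhds 0) := by
    simpa using tendsto_one_div_add_atTop_nhds_zero_nat.const_mul ((1 + α / c) * w)
  refine squeeze_zero (fun k => by positivity) (fun k => ?_) h0
  have hk := kummerTerm_pos hα hc hw k
  rw [← norm_div, kummerTerm_succ hα hc, mul_div_cancel_right₀ _ hk.ne',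
    Real.norm_of_nonneg (by positivity), mul_assoc, mul_one_div]
  gcongr
  rw [div_le_iff₀ (by positivity)]
  have : 0 ≤ α / c * k := by positivity
  have h2 : α / c * c = α := by field_simp
  nlinarith

/-- The shift in the first parameter, term by term. -/
theorem kummerTerm_add_one {α c : ℝ} (hα : 0 < α) (hc : 0 < c) (w : ℝ) (k : ℕ) :
    kummerTerm (α + 1) c w (k + 1) =
      kummerTerm α c w (k + 1) + w / c * kummerTerm (α + 1) (c + 1) w k := by
  have hαk : 0 < α + 1 + k := by positivity
  have hck : 0 < c + 1 + k := by positivity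
  have h1 := (Real.Gamma_pos_of_pos hα).ne'
  have h2 := (Real.Gamma_pos_of_pos hc).ne'
  have h3 := (Real.Gamma_pos_of_pos hck).ne'
  unfold kummerTerm
  rw [Nat.factorial_succ, Nat.cast_succ, show α + 1 + ((k : ℝ) + 1) = α + 1 + k + 1 by ring,
    show α + ((k : ℝ) + 1) = α + 1 + k by ring, show c + ((k : ℝ) + 1) = c + 1 + k by ring,
    Real.Gamma_add_one hαk.ne', Real.Gamma_add_one hα.ne', Real.Gamma_add_one hc.ne']
  push_cast
  field_simp
  ring

theorem tsum_kummerTerm_add_one {α c w : ℝ} (hα : 0 < α) (hc : 0 < c) (hw : 0 < w) :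
    ∑' k, kummerTerm (α + 1) c w k =
      ∑' k, kummerTerm α c w k + w / c * ∑' k, kummerTerm (α + 1) (c + 1) w k := by
  have hα' : 0 < α + 1 := by positivity
  have hs := summable_kummerTerm hα hc hw
  rw [(summable_kummerTerm hα' hc hw).tsum_eq_zero_add, hs.tsum_eq_zero_add,
    kummerTerm_zero hα' hc, kummerTerm_zero hα hc, add_assoc, ← tsum_mul_left,
    ← ((summable_nat_add_iff 1).2 hs).tsum_add
      ((summable_kummerTerm hα' (by positivity) hw).mul_left _)]
  simp_rw [kummerTerm_add_one hα hc]

theorem tsum_kummerTerm_pos {α c w : ℝ} (hα : 0 < α) (hc : 0 < c) (hw : 0 < w) :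
    0 < ∑' k, kummerTerm α c w k :=
  (summable_kummerTerm hα hc hw).tsum_pos (fun k => (kummerTerm_pos hα hc hw k).le) 0
    (kummerTerm_pos hα hc hw 0)

/-- Integral of an unnormalised Gamma density against a noncentral chi-square likelihood. -/
theorem integral_gamma_mul_noncentral_chisq {s b c y : ℝ} (hs : 0 < s) (hb : 0 < b)
    (hc : 0 < c) (hy : 0 < y) :
    ∫ θ in Set.Ioi (0 : ℝ), θ ^ (s - 1) * Real.exp (-(b * θ)) *
        ∑' k : ℕ, (Real.exp (-θ) * θ ^ k / (Nat.factorial k : ℝ)) *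
          (y ^ (c + (k : ℝ) - 1) * Real.exp (-y) / (2 * Real.Gamma (c + k))) =
      y ^ (c - 1) * Real.exp (-y) / (2 * Real.Gamma c) *
        ((1 / (1 + b)) ^ s * Real.Gamma s) * ∑' k, kummerTerm s c (y / (1 + b)) k := by
  have hb1 : 0 < 1 + b := by positivity
  have hΓs := Real.Gamma_pos_of_pos hs
  have hΓc := Real.Gamma_pos_of_pos hc
  have hΓ (k : ℕ) : 0 < Real.Gamma (c + k) := Real.Gamma_pos_of_pos (by positivity)
  let A (k : ℕ) : ℝ :=
    y ^ (c + (k : ℝ) - 1) * Real.exp (-y) / (2 * Real.Gamma (c + k)) / (Nat.factorial k : ℝ)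
  let G (k : ℕ) (θ : ℝ) : ℝ := A k * (θ ^ (s + k - 1) * Real.exp (-((1 + b) * θ)))
  have hA (k : ℕ) : 0 < A k := by
    have := hΓ k
    positivity
  have hint (k : ℕ) : ∫ θ in Set.Ioi (0 : ℝ), G k θ =
      y ^ (c - 1) * Real.exp (-y) / (2 * Real.Gamma c) *
        ((1 / (1 + b)) ^ s * Real.Gamma s) * kummerTerm s c (y / (1 + b)) k := by
    have h1 := (hΓ k).ne'
    rw [integral_const_mul, Real.integral_rpow_mul_exp_neg_mul_Ioi (by positivity) hb1,
      Real.rpow_add_natCast (by positivity)]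
    simp only [A, kummerTerm]
    rw [show c + (k : ℝ) - 1 = c - 1 + k by ring, Real.rpow_add_natCast hy.ne']
    field_simp
    rw [← mul_pow, mul_one_div]
  have hpos (k : ℕ) : 0 < ∫ θ in Set.Ioi (0 : ℝ), G k θ := by
    rw [hint]
    have := kummerTerm_pos hs hc (div_pos hy hb1) k
    positivity
  have hnorm (k : ℕ) : ∫ θ in Set.Ioi (0 : ℝ), ‖G k θ‖ = ∫ θ in Set.Ioi (0 : ℝ), G k θ := by
    refine setIntegral_congr_fun measurableSet_Ioi fun θ hθ => Real.norm_of_nonneg ?_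
    have hθ' : 0 < θ := hθ
    have := hA k
    positivity
  have hsum := hasSum_integral_of_summable_integral_norm
    (fun k => Integrable.of_integral_ne_zero (hpos k).ne') (by
      simp_rw [hnorm, hint]
      exact (summable_kummerTerm hs hc (div_pos hy hb1)).mul_left _)
  rw [← tsum_mul_left, ← tsum_congr hint, hsum.tsum_eq]
  refine setIntegral_congr_fun measurableSet_Ioi fun θ hθ => ?_
  have hθ' : 0 < θ := hθ
  simp only [← tsum_mul_left]
  refine tsum_congr fun k => ?_
  simp only [G, A]
  rw [show s + (k : ℝ) - 1 = s - 1 + k by ring, Real.rpow_add_natCast hθ'.ne',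
    show -((1 + b) * θ) = -(b * θ) + -θ by ring, Real.exp_add]
  ring

/-- Example 3.1, formula (3.5): posterior mean of the noncentrality parameter θ under the
noncentral chi-square model X|θ ~ χ²_p(2θ) and a Gamma G(a,b) prior. -/
theorem noncentral_chisq_posterior_mean
    (p a b x : ℝ) (hp : 0 < p) (ha : 0 < a) (hb : 0 < b) (hx : 0 < x)
    (z : ℝ) (hz : z = x / (2 * (1 + b)))
    (F : ℝ → ℝ → ℝ → ℝ)
    (hF : ∀ α c w, F α c w = ∑' k : ℕ,
      (Real.Gamma (α + k) / Real.Gamma α) * w ^ k /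
        ((Real.Gamma (c + k) / Real.Gamma c) * (Nat.factorial k : ℝ)))
    (f : ℝ → ℝ)
    (hf : ∀ θ, f θ = ∑' k : ℕ,
      (Real.exp (-θ) * θ ^ k / (Nat.factorial k : ℝ)) *
        ((x / 2) ^ (p / 2 + (k : ℝ) - 1) * Real.exp (-(x / 2)) /
          (2 * Real.Gamma (p / 2 + k))))
    (π : ℝ → ℝ)
    (hπ : ∀ θ, π θ = b ^ a * θ ^ (a - 1) * Real.exp (-(b * θ)) / Real.Gamma a) :
    (∫ θ in Set.Ioi (0 : ℝ), θ * (π θ * f θ)) / (∫ θ in Set.Ioi (0 : ℝ), π θ * f θ) =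
      (a / (1 + b)) * (1 + (x / (p * (1 + b))) *
        (F (a + 1) (p / 2 + 1) z / F a (p / 2) z)) := by
  have hp2 : 0 < p / 2 := by positivity
  have hx2 : 0 < x / 2 := by positivity
  have hb1 : 0 < 1 + b := by positivity
  have hz' : x / 2 / (1 + b) = z := by rw [hz, div_div]
  have hz0 : 0 < z := by rw [hz]; positivity
  have hF' (α c : ℝ) : F α c z = ∑' k, kummerTerm α c z k := hF α c z
  have hΓa := Real.Gamma_pos_of_pos ha
  have hΓp := Real.Gamma_pos_of_pos hp2
  have hden : ∫ θ in Set.Ioi (0 : ℝ), π θ * f θ = b ^ a / Real.Gamma a *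
      ∫ θ in Set.Ioi (0 : ℝ), θ ^ (a - 1) * Real.exp (-(b * θ)) * f θ := by
    rw [← integral_const_mul]
    congr 1 with θ
    rw [hπ]
    ring
  have hnum : ∫ θ in Set.Ioi (0 : ℝ), θ * (π θ * f θ) = b ^ a / Real.Gamma a *
      ∫ θ in Set.Ioi (0 : ℝ), θ ^ (a + 1 - 1) * Real.exp (-(b * θ)) * f θ := by
    rw [← integral_const_mul]
    refine setIntegral_congr_fun measurableSet_Ioi fun θ hθ => ?_
    have hθ' : θ ≠ 0 := ne_of_gt hθ
    simp only [hπ]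
    rw [show a + 1 - 1 = a - 1 + 1 by ring, Real.rpow_add_one hθ']
    ring
  simp_rw [hden, hnum, hf]
  rw [integral_gamma_mul_noncentral_chisq ha hb hp2 hx2,
    integral_gamma_mul_noncentral_chisq (by positivity : 0 < a + 1) hb hp2 hx2, hz', hF', hF',
    tsum_kummerTerm_add_one ha hp2 hz0, Real.Gamma_add_one ha.ne',
    Real.rpow_add_one (by positivity)]
  have hS := tsum_kummerTerm_pos ha hp2 hz0
  have hzp : x / (p * (1 + b)) = z / (p / 2) := by
    rw [hz]
    field_simp
  rw [hzp]
  generalize ∑' k, kummerTerm a (p / 2) z k = S at *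
  have hba : 0 < b ^ a := by positivity
  have hxp : 0 < (x / 2) ^ (p / 2 - 1) := by positivity
  have hr : 0 < (1 / (1 + b)) ^ a := by positivity
  generalize (1 / (1 + b)) ^ a = r at *
  generalize (x / 2) ^ (p / 2 - 1) = q at *
  field_simp
end

section
/- Let p, b, x > 0. Suppose the model density of X given θ > 0 is f(x|θ) = Σ_{k=0}^∞ (e^{-θ} θ^k/k!) · (x/2)^{p/2+k-1} e^{-x/2}/(2 Γ(p/2+k)) (the noncentral chi-square χ²_p(2θ) density), and the prior density is π(θ) = b^{p/2} θ^{p/2-1} e^{-bθ}/Γ(p/2), i.e. a Gamma G(p/2, b) prior. Then the posterior mean satisfies ∫₀^∞ θ π(θ) f(x|θ) dθ / ∫₀^∞ π(θ) f(x|θ) dθ = p/(2(1+b)) + x/(2(1+b)²). -/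
open MeasureTheory

/-- Termwise integration of a nonnegative mixture of unnormalised Gamma densities. -/
lemma integral_tsum_rpow_mul_exp_neg_mul {s r S : ℝ} (hs : 0 < s) (hr : 0 < r) {c : ℕ → ℝ}
    (hc : ∀ k, 0 ≤ c k)
    (hS : HasSum (fun k : ℕ => c k * ((1 / r) ^ (s + k) * Real.Gamma (s + k))) S) :
    ∫ θ in Set.Ioi (0 : ℝ), ∑' k : ℕ, c k * (θ ^ (s + k - 1) * Real.exp (-(r * θ))) = S := by
  have hsk (k : ℕ) : 0 < s + k := by positivity
  have hint (k : ℕ) : ∫ θ in Set.Ioi (0 : ℝ), c k * (θ ^ (s + k - 1) * Real.exp (-(r * θ))) =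
      c k * ((1 / r) ^ (s + k) * Real.Gamma (s + k)) := by
    rw [integral_const_mul, Real.integral_rpow_mul_exp_neg_mul_Ioi (hsk k) hr]
  have hnorm (k : ℕ) : ∫ θ in Set.Ioi (0 : ℝ), ‖c k * (θ ^ (s + k - 1) * Real.exp (-(r * θ)))‖ =
      c k * ((1 / r) ^ (s + k) * Real.Gamma (s + k)) := by
    rw [← hint k]
    refine setIntegral_congr_fun measurableSet_Ioi fun θ hθ => ?_
    have hθ' : 0 < θ := hθ
    have := hc k
    exact Real.norm_of_nonneg (by positivity)
  have hsum := hasSum_integral_of_summable_integral_norm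
    (μ := volume.restrict (Set.Ioi (0 : ℝ)))
    (F := fun (k : ℕ) θ => c k * (θ ^ (s + k - 1) * Real.exp (-(r * θ)))) (fun k => by
      have h := integrableOn_rpow_mul_exp_neg_mul_rpow (p := 1) (s := s + k - 1)
        (by linarith [hsk k]) one_pos hr
      simp only [Real.rpow_one, neg_mul] at h
      exact h.const_mul (c k)) (by simpa only [hnorm] using hS.summable)
  simp only [hint] at hsum
  exact hsum.unique hS

lemma hasSum_pow_div_factorial (z : ℝ) :
    HasSum (fun k : ℕ => z ^ k / (k.factorial : ℝ)) (Real.exp z) := by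
  rw [Real.exp_eq_exp_ℝ]
  exact NormedSpace.expSeries_div_hasSum_exp z

lemma hasSum_nat_mul_pow_div_factorial (z : ℝ) :
    HasSum (fun k : ℕ => (k : ℝ) * (z ^ k / (k.factorial : ℝ))) (z * Real.exp z) := by
  rw [← hasSum_nat_add_iff' 1]
  simp only [Finset.range_one, Finset.sum_singleton, Nat.cast_zero, zero_mul, sub_zero]
  refine ((hasSum_pow_div_factorial z).mul_left z).congr_fun fun k => ?_
  rw [Nat.factorial_succ]
  push_cast
  field_simp
  ring

/-- Example 3.1 (Saxena–Alam case a = p/2): posterior mean of θ under the noncentral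
chi-square model X|θ ~ χ²_p(2θ) and Gamma G(p/2, b) prior is linear in x. -/
theorem noncentral_chisq_posterior_mean_linear
    (p b x : ℝ) (hp : 0 < p) (hb : 0 < b) (hx : 0 < x)
    (f : ℝ → ℝ)
    (hf : ∀ θ, f θ = ∑' k : ℕ,
      (Real.exp (-θ) * θ ^ k / (Nat.factorial k : ℝ)) *
        ((x / 2) ^ (p / 2 + (k : ℝ) - 1) * Real.exp (-(x / 2)) /
          (2 * Real.Gamma (p / 2 + k))))
    (π : ℝ → ℝ)
    (hπ : ∀ θ, π θ = b ^ (p / 2) * θ ^ (p / 2 - 1) * Real.exp (-(b * θ)) /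
      Real.Gamma (p / 2)) :
    (∫ θ in Set.Ioi (0 : ℝ), θ * (π θ * f θ)) / (∫ θ in Set.Ioi (0 : ℝ), π θ * f θ) =
      p / (2 * (1 + b)) + x / (2 * (1 + b) ^ 2) := by
  set q := p / 2
  set y := x / 2
  set r := 1 + b with hr
  have hq0 : 0 < q := by positivity
  have hy0 : 0 < y := by positivity
  have hr0 : 0 < r := by positivity
  set C := b ^ q / Real.Gamma q * (y ^ (q - 1) * Real.exp (-y) / 2) with hC
  have hC0 : 0 < C := by
    have := Real.Gamma_pos_of_pos hq0
    positivity
  set c : ℕ → ℝ := fun k => C * (y ^ k / (k.factorial * Real.Gamma (q + k))) with hc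
  have hΓ (k : ℕ) : 0 < Real.Gamma (q + k) := Real.Gamma_pos_of_pos (by positivity)
  have hc0 (k : ℕ) : 0 ≤ c k := by
    have := hΓ k
    positivity
  have hmix (θ : ℝ) (hθ : 0 < θ) :
      π θ * f θ = ∑' k : ℕ, c k * (θ ^ (q + k - 1) * Real.exp (-(r * θ))) := by
    rw [hf, hπ, ← tsum_mul_left]
    refine tsum_congr fun k => ?_
    have hθk : θ ^ (q + k - 1) = θ ^ (q - 1) * θ ^ k := by
      rw [← Real.rpow_natCast, ← Real.rpow_add hθ]; ring_nf
    have hyk : y ^ (q + k - 1) = y ^ (q - 1) * y ^ k := by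
      rw [← Real.rpow_natCast, ← Real.rpow_add hy0]; ring_nf
    have hexp : Real.exp (-(r * θ)) = Real.exp (-(b * θ)) * Real.exp (-θ) := by
      rw [← Real.exp_add, hr]; ring_nf
    rw [hθk, hyk, hexp, hc, hC]
    have := (hΓ k).ne'
    have := (Real.Gamma_pos_of_pos hq0).ne'
    field_simp
  have hmoment (θ : ℝ) (hθ : 0 < θ) :
      θ * (π θ * f θ) = ∑' k : ℕ, c k * (θ ^ (q + 1 + k - 1) * Real.exp (-(r * θ))) := by
    rw [hmix θ hθ, ← tsum_mul_left]
    refine tsum_congr fun k => ?_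
    rw [show q + 1 + k - 1 = (q + k - 1) + 1 by ring, Real.rpow_add_one hθ.ne']
    ring
  have hpow (k : ℕ) : (1 / r) ^ (q + k) = (1 / r) ^ q * (1 / r) ^ k := by
    rw [Real.rpow_add (by positivity), Real.rpow_natCast]
  have hden : ∫ θ in Set.Ioi (0 : ℝ), π θ * f θ = C * (1 / r) ^ q * Real.exp (y / r) := by
    rw [setIntegral_congr_fun measurableSet_Ioi hmix]
    refine integral_tsum_rpow_mul_exp_neg_mul hq0 hr0 hc0 ?_
    refine ((hasSum_pow_div_factorial (y / r)).mul_left (C * (1 / r) ^ q)).congr_fun fun k => ?_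
    have := (hΓ k).ne'
    rw [hpow, hc, div_pow, div_pow, one_pow]
    field_simp
  have hnum : ∫ θ in Set.Ioi (0 : ℝ), θ * (π θ * f θ) =
      C * (1 / r) ^ q / r * (q * Real.exp (y / r) + y / r * Real.exp (y / r)) := by
    rw [setIntegral_congr_fun measurableSet_Ioi hmoment]
    refine integral_tsum_rpow_mul_exp_neg_mul (by positivity) hr0 hc0 ?_
    refine ((((hasSum_pow_div_factorial (y / r)).mul_left q).add
      (hasSum_nat_mul_pow_div_factorial (y / r))).mul_left
        (C * (1 / r) ^ q / r)).congr_fun fun k => ?_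
    have := (hΓ k).ne'
    have hqk : q + k ≠ 0 := by positivity
    rw [show q + 1 + k = (q + k) + 1 by ring, Real.Gamma_add_one hqk,
      Real.rpow_add_one (by positivity), hpow, hc, div_pow, div_pow, one_pow]
    field_simp
  have hpos : 0 < (1 / r) ^ q := by positivity
  rw [hnum, hden, show p = 2 * q by ring, show x = 2 * y by ring]
  field_simp
end

section
/- Let p, a, b, x > 0 and set z₁ = x/(2(1+b)) and z₂ = x/(2(2+b)). For j, k ∈ ℕ let nb(j; r, ξ) = ((r)_j/j!) ξ^r (1-ξ)^j denote the negative binomial NB(r,ξ) p.m.f., where (r)_j = Γ(r+j)/Γ(r). Then for every j ∈ ℕ: Σ_{k=0}^∞ nb(j; a+k, (1+b)/(2+b)) · [(a)_k z₁^k / ((p/2)_k k! · ₁F₁(a; p/2; z₁))] = ((a)_j/j!) ((1+b)/(2+b))^a (1/(2+b))^j · ₁F₁(a+j; p/2; z₂)/₁F₁(a; p/2; z₁), where ₁F₁(a; c; z) = Σ_{k≥0} (a)_k z^k/((c)_k k!). -/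
open MeasureTheory

/-- Example 3.2: closed form of the predictive mixing p.m.f. h'_x for the noncentral
chi-square model, as a weighted negative binomial NB(a, (1+b)/(2+b)) p.m.f. with a ratio of
confluent hypergeometric functions as weight. -/
theorem noncentral_chisq_predictive_mixing
    (p a b x : ℝ) (hp : 0 < p) (ha : 0 < a) (hb : 0 < b) (hx : 0 < x)
    (z₁ z₂ : ℝ) (hz₁ : z₁ = x / (2 * (1 + b))) (hz₂ : z₂ = x / (2 * (2 + b)))
    (poch : ℝ → ℕ → ℝ)
    (hpoch : ∀ c k, poch c k = Real.Gamma (c + k) / Real.Gamma c)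
    (F : ℝ → ℝ → ℝ → ℝ)
    (hF : ∀ α c w, F α c w = ∑' k : ℕ,
      (Real.Gamma (α + k) / Real.Gamma α) * w ^ k /
        ((Real.Gamma (c + k) / Real.Gamma c) * (Nat.factorial k : ℝ)))
    (nb : ℕ → ℝ → ℝ → ℝ)
    (hnb : ∀ (j : ℕ) (r ξ : ℝ), nb j r ξ =
      (Real.Gamma (r + j) / Real.Gamma r) / (Nat.factorial j : ℝ) * ξ ^ r * (1 - ξ) ^ j) :
    ∀ j : ℕ,
      (∑' k : ℕ, nb j (a + k) ((1 + b) / (2 + b)) *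
        (poch a k * z₁ ^ k / (poch (p / 2) k * (Nat.factorial k : ℝ) * F a (p / 2) z₁))) =
      (poch a j / (Nat.factorial j : ℝ)) * ((1 + b) / (2 + b)) ^ a *
        (1 / (2 + b)) ^ j * (F (a + j) (p / 2) z₂ / F a (p / 2) z₁) := by
  intro j
  have hξ : 1 - (1 + b) / (2 + b) = 1 / (2 + b) := by field_simp; ring
  have hz : z₂ = (1 + b) / (2 + b) * z₁ := by rw [hz₁, hz₂]; field_simp
  have hξ_pos : 0 < (1 + b) / (2 + b) := by positivity
  rw [hF (a + j), div_eq_mul_inv _ (F a (p / 2) z₁), ← tsum_mul_right, ← tsum_mul_left]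
  refine tsum_congr fun k => ?_
  rw [hnb, hpoch, hpoch, hpoch, hξ, hz, Real.rpow_add_natCast hξ_pos.ne', mul_pow,
    add_right_comm a (k : ℝ) (j : ℝ), div_eq_mul_inv _ (_ * F a (p / 2) z₁), mul_inv]
  have hGk : Real.Gamma (a + k) ≠ 0 := (Real.Gamma_pos_of_pos (by positivity)).ne'
  have hGj : Real.Gamma (a + j) ≠ 0 := (Real.Gamma_pos_of_pos (by positivity)).ne'
  generalize (F a (p / 2) z₁)⁻¹ = D
  generalize ((1 + b) / (2 + b)) ^ a = A
  generalize (1 + b) / (2 + b) = ξ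
  generalize 1 / (2 + b) = η
  field_simp
end

section
/- Let c > 0 and β₁, β₂ > 0 with β₁ + β₂ < 1, and set p₁ = β₁/(1-β₂) and p₂ = 1-β₂. Then for all k₁, k₂ ∈ ℕ: ((c)_{k₁+k₂}/(k₁! k₂!)) β₁^{k₁} β₂^{k₂} (1-β₁-β₂)^c = [((c)_{k₁}/k₁!)(1-p₁)^c p₁^{k₁}] · [((c+k₁)_{k₂}/k₂!) p₂^{c+k₁} (1-p₂)^{k₂}], where (c)_k = Γ(c+k)/Γ(c); consequently Σ_{k₁=0}^∞ Σ_{k₂=0}^∞ ((c)_{k₁+k₂}/(k₁! k₂!)) β₁^{k₁} β₂^{k₂} = (1-β₁-β₂)^{-c}. -/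
open MeasureTheory

/-- The rising factorial as a quotient of values of the real Gamma function. -/
theorem Real.Gamma_add_nat_div_Gamma_eq {c : ℝ} (hc : 0 < c) (n : ℕ) :
    Real.Gamma (c + n) / Real.Gamma c = (ascPochhammer ℝ n).eval c := by
  induction n with
  | zero => simp [(Real.Gamma_pos_of_pos hc).ne']
  | succ n ih =>
    have hcn : c + n ≠ 0 := by positivity
    rw [ascPochhammer_succ_eval, ← ih, Nat.cast_succ, ← add_assoc, Real.Gamma_add_one hcn]
    ring

/-- The negative binomial series. -/
theorem Real.hasSum_Gamma_mul_pow {c x : ℝ} (hc : 0 < c) (hx : |x| < 1) :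
    HasSum (fun n : ℕ ↦ Real.Gamma (c + n) / Real.Gamma c / (n.factorial : ℝ) * x ^ n)
      ((1 - x) ^ (-c)) := by
  have hmem : x ∈ Metric.eball (0 : ℝ) 1 := by
    simpa [enorm_eq_nnnorm, ← NNReal.coe_lt_coe] using hx
  have h := (Real.one_div_one_sub_rpow_hasFPowerSeriesOnBall_zero c).hasSum hmem
  have hx' : 0 ≤ 1 - x := by linarith [le_abs_self x]
  rw [zero_add, one_div, ← Real.rpow_neg hx'] at h
  refine h.congr_fun fun n ↦ ?_
  have hchoose : (n.factorial : ℝ) * Ring.choose (c + n - 1) n = (ascPochhammer ℝ n).eval c := by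
    rw [← Polynomial.ascPochhammer_smeval_eq_eval, ← Ring.factorial_nsmul_multichoose_eq_ascPochhammer,
      nsmul_eq_mul, Ring.choose]
    congr 2
    ring
  rw [Real.Gamma_add_nat_div_Gamma_eq hc, ← hchoose,
    mul_div_cancel_left₀ _ (Nat.cast_ne_zero.2 n.factorial_ne_zero)]
  simp [mul_comm]

/-- Example 3.3: the bivariate power-series p.m.f. proportional to
(c)_{k₁+k₂} β₁^{k₁} β₂^{k₂}/(k₁! k₂!) factorizes as the product of a NB(c, 1-p₁) marginal and
a NB(c+k₁, p₂) conditional, and the corresponding double series sums to (1-β₁-β₂)^{-c}. -/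
theorem doubly_noncentral_F_mixing_factorization
    (c β₁ β₂ : ℝ) (hc : 0 < c) (hβ₁ : 0 < β₁) (hβ₂ : 0 < β₂) (hsum : β₁ + β₂ < 1)
    (p₁ p₂ : ℝ) (hp₁ : p₁ = β₁ / (1 - β₂)) (hp₂ : p₂ = 1 - β₂) :
    (∀ k₁ k₂ : ℕ,
      (Real.Gamma (c + k₁ + k₂) / Real.Gamma c) /
          ((Nat.factorial k₁ : ℝ) * (Nat.factorial k₂ : ℝ)) *
          β₁ ^ k₁ * β₂ ^ k₂ * (1 - β₁ - β₂) ^ c =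
        ((Real.Gamma (c + k₁) / Real.Gamma c) / (Nat.factorial k₁ : ℝ) *
            (1 - p₁) ^ c * p₁ ^ k₁) *
        ((Real.Gamma (c + k₁ + k₂) / Real.Gamma (c + k₁)) / (Nat.factorial k₂ : ℝ) *
            p₂ ^ (c + (k₁ : ℝ)) * (1 - p₂) ^ k₂)) ∧
    (∑' k₁ : ℕ, ∑' k₂ : ℕ,
        (Real.Gamma (c + k₁ + k₂) / Real.Gamma c) /
          ((Nat.factorial k₁ : ℝ) * (Nat.factorial k₂ : ℝ)) * β₁ ^ k₁ * β₂ ^ k₂) =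
      (1 - β₁ - β₂) ^ (-c) := by
  have hΓ (k : ℕ) : Real.Gamma (c + k) ≠ 0 := (Real.Gamma_pos_of_pos (by positivity)).ne'
  have hq : 0 < 1 - β₂ := by linarith
  have hr : 0 < 1 - β₁ - β₂ := by linarith
  have hp : 1 - p₁ = (1 - β₁ - β₂) / (1 - β₂) := by
    rw [hp₁]
    field_simp
    ring
  constructor
  · intro k₁ k₂
    have hk := hΓ k₁
    rw [hp, hp₁, hp₂, Real.div_rpow hr.le hq.le, Real.rpow_add hq, Real.rpow_natCast, div_pow,
      sub_sub_cancel]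
    have hqc := (Real.rpow_pos_of_pos hq c).ne'
    field_simp
  · have hinner (k₁ : ℕ) :
        ∑' k₂ : ℕ, (Real.Gamma (c + k₁ + k₂) / Real.Gamma c) /
          ((Nat.factorial k₁ : ℝ) * (Nat.factorial k₂ : ℝ)) * β₁ ^ k₁ * β₂ ^ k₂ =
        (1 - β₂) ^ (-c) *
          (Real.Gamma (c + k₁) / Real.Gamma c / (Nat.factorial k₁ : ℝ) * p₁ ^ k₁) := by
      have hsum₂ := Real.hasSum_Gamma_mul_pow (c := c + k₁) (x := β₂) (by positivity)
        (by rw [abs_of_pos hβ₂]; linarith)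
      convert (hsum₂.mul_left
        (Real.Gamma (c + k₁) / Real.Gamma c / (Nat.factorial k₁ : ℝ) * β₁ ^ k₁)).tsum_eq using 1
      · refine tsum_congr fun k₂ ↦ ?_
        have hk := hΓ k₁
        field_simp
      · rw [hp₁, neg_add, Real.rpow_add hq, Real.rpow_neg hq.le (k₁ : ℝ), Real.rpow_natCast,
          div_pow]
        ring
    have hp₁_pos : 0 < p₁ := hp₁ ▸ div_pos hβ₁ hq
    have hp₁_lt : p₁ < 1 := by
      rw [hp₁, div_lt_one hq]
      linarith
    simp_rw [hinner]
    rw [((Real.hasSum_Gamma_mul_pow hc (by rwa [abs_of_pos hp₁_pos])).mul_left _).tsum_eq, hp,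
      ← Real.mul_rpow hq.le (div_nonneg hr.le hq.le), mul_div_cancel₀ _ hq.ne']
end

section
/- Let a, c, α, a', b, x > 0, and define ψ(γ₁, γ₂, γ₃) = (1/Γ(γ₁)) ∫₀^∞ t^{γ₁-1} (1+t)^{γ₂-γ₁-1} e^{-γ₃ t} dt for γ₁, γ₃ > 0 and γ₂ ∈ ℝ (the confluent hypergeometric function of type II). Then for every j' > 0: ∫₀^∞ [Γ(a'+a+c) (b+k)^{a+c} j'^{a'-1} / (Γ(a') Γ(a+c) (b+k+j')^{a'+a+c})] · [b^{c-α} k^{a+α-1} e^{-xk} / (Γ(a+α) ψ(a+α, 1+α-c, bx) (k+b)^{a+c})] dk = [Γ(a'+a+c)/(Γ(a') Γ(a+c))] · b^{c-α} j'^{a'-1} (j'+b)^{-(a'+c-α)} · ψ(a+α, 1+α-a'-c, (j'+b)x) / ψ(a+α, 1+α-c, bx). -/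
open MeasureTheory

/-- Rescaling `k = s * t` in a Laplace-type integral of `k ^ (p - 1) * (s + k) ^ (-q)`. -/
theorem integral_rpow_mul_add_rpow_mul_exp (p q x : ℝ) {s : ℝ} (hs : 0 < s) :
    ∫ k in Set.Ioi (0 : ℝ), k ^ (p - 1) * (s + k) ^ (-q) * Real.exp (-(x * k)) =
      s ^ (p - q) *
        ∫ t in Set.Ioi (0 : ℝ), t ^ (p - 1) * (1 + t) ^ (-q) * Real.exp (-(s * x * t)) := by
  have h := integral_comp_mul_left_Ioi'
    (fun k : ℝ => k ^ (p - 1) * (s + k) ^ (-q) * Real.exp (-(x * k))) 0 hs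
  rw [mul_zero] at h
  rw [← h, smul_eq_mul, ← integral_const_mul, ← integral_const_mul]
  refine setIntegral_congr_fun measurableSet_Ioi fun t ht => ?_
  have ht : 0 < t := ht
  have hpow : s ^ (p - q) = s * s ^ (p - 1) * s ^ (-q) := by
    nth_rewrite 2 [← Real.rpow_one s]
    rw [← Real.rpow_add hs, ← Real.rpow_add hs]
    ring_nf
  have hadd : s + s * t = s * (1 + t) := by ring
  have hexp : x * (s * t) = s * x * t := by ring
  simp only [hadd, hexp]
  rw [Real.mul_rpow hs.le ht.le, Real.mul_rpow hs.le (by positivity), hpow]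
  ring

/-- Example 3.4: the mixing density h'_x of the Bayes predictive distribution for univariate
Gamma mixtures, obtained by integrating the product of a Beta type II density and a Kummer
type II density, expressed as a ratio of confluent hypergeometric ψ functions. -/
theorem gamma_mixture_predictive_mixing_density
    (a c α a' b x : ℝ)
    (ha : 0 < a) (hc : 0 < c) (hα : 0 < α) (ha' : 0 < a') (hb : 0 < b) (hx : 0 < x)
    (ψ : ℝ → ℝ → ℝ → ℝ)
    (hψ : ∀ γ₁ γ₂ γ₃, ψ γ₁ γ₂ γ₃ = (1 / Real.Gamma γ₁) *
      ∫ t in Set.Ioi (0 : ℝ), t ^ (γ₁ - 1) * (1 + t) ^ (γ₂ - γ₁ - 1) * Real.exp (-(γ₃ * t))) :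
    ∀ j' : ℝ, 0 < j' →
      (∫ k in Set.Ioi (0 : ℝ),
        (Real.Gamma (a' + a + c) * (b + k) ^ (a + c) * j' ^ (a' - 1) /
          (Real.Gamma a' * Real.Gamma (a + c) * (b + k + j') ^ (a' + a + c))) *
        (b ^ (c - α) * k ^ (a + α - 1) * Real.exp (-(x * k)) /
          (Real.Gamma (a + α) * ψ (a + α) (1 + α - c) (b * x) * (k + b) ^ (a + c)))) =
      (Real.Gamma (a' + a + c) / (Real.Gamma a' * Real.Gamma (a + c))) *
        b ^ (c - α) * j' ^ (a' - 1) * (j' + b) ^ (-(a' + c - α)) *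
        (ψ (a + α) (1 + α - a' - c) ((j' + b) * x) / ψ (a + α) (1 + α - c) (b * x)) := by
  intro j' hj
  have hs : 0 < j' + b := by positivity
  have key := integral_rpow_mul_add_rpow_mul_exp (a + α) (a' + a + c) x hs
  have he₁ : a + α - (a' + a + c) = -(a' + c - α) := by ring
  have he₂ : 1 + α - a' - c - (a + α) - 1 = -(a' + a + c) := by ring
  rw [he₁] at key
  rw [hψ (a + α) (1 + α - a' - c), he₂]
  generalize ψ (a + α) (1 + α - c) (b * x) = D
  trans ∫ k in Set.Ioi (0 : ℝ),
      (Real.Gamma (a' + a + c) / (Real.Gamma a' * Real.Gamma (a + c)) * b ^ (c - α) *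
        j' ^ (a' - 1) * (1 / Real.Gamma (a + α)) / D) *
      (k ^ (a + α - 1) * (j' + b + k) ^ (-(a' + a + c)) * Real.exp (-(x * k)))
  · refine setIntegral_congr_fun measurableSet_Ioi fun k hk => ?_
    have hk : 0 < k := hk
    have hbk : (b + k) ^ (a + c) ≠ 0 := (Real.rpow_pos_of_pos (by positivity) _).ne'
    have hadd : b + k + j' = j' + b + k := by ring
    simp only [hadd, add_comm k b]
    rw [Real.rpow_neg (by positivity : 0 ≤ j' + b + k)]
    field_simp
  · rw [integral_const_mul, key]
    ring
end

section
/- Let n₁, n₂ be reals with n₁, n₂ ≥ 2, let a, b, s, s', j', k' > 0 and r, r' ∈ ℝ with r' ≠ r. Set B₀ = j's' + k's + b + n₂j'r' + n₁k'r and c(r') = |r'-r| · (n₂j' if r' > r, n₁k' if r' < r). Then ∫₀^∞ ρ^{a+n₁+n₂-1} e^{-ρB₀} (∫_{-∞}^{min(r,r')} e^{ρμ(n₂j' + n₁k')} dμ) dρ = Γ(a+n₁+n₂-1) / ((n₂j' + n₁k') · (j's' + k's + b + c(r'))^{a+n₁+n₂-1}). -/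
open MeasureTheory

/-- Example 4.2 (multivariate Lomax predictive computation): closed-form evaluation of the
double integral over the rate ρ and the location μ appearing in the Bayes predictive density
q_π(s',r'|j',k') for mixtures of location-scale exponential distributions. -/
theorem lomax_predictive_double_integral
    (n₁ n₂ : ℝ) (hn₁ : 2 ≤ n₁) (hn₂ : 2 ≤ n₂)
    (a b s s' j' k' : ℝ)
    (ha : 0 < a) (hb : 0 < b) (hs : 0 < s) (hs' : 0 < s') (hj' : 0 < j') (hk' : 0 < k')
    (r r' : ℝ) (hrr' : r' ≠ r)
    (B₀ : ℝ) (hB₀ : B₀ = j' * s' + k' * s + b + n₂ * j' * r' + n₁ * k' * r)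
    (cr' : ℝ) (hcr' : cr' = |r' - r| * (if r < r' then n₂ * j' else n₁ * k')) :
    (∫ ρ in Set.Ioi (0 : ℝ), ρ ^ (a + n₁ + n₂ - 1) * Real.exp (-(ρ * B₀)) *
        ∫ μ in Set.Iic (min r r'), Real.exp (ρ * μ * (n₂ * j' + n₁ * k'))) =
      Real.Gamma (a + n₁ + n₂ - 1) /
        ((n₂ * j' + n₁ * k') *
          (j' * s' + k' * s + b + cr') ^ (a + n₁ + n₂ - 1)) := by
  have hD : 0 < n₂ * j' + n₁ * k' := by positivity
  have hA : 0 < a + n₁ + n₂ - 1 := by linarith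
  have hC : B₀ - min r r' * (n₂ * j' + n₁ * k') = j' * s' + k' * s + b + cr' := by
    rcases lt_or_gt_of_ne hrr' with h | h
    · rw [hB₀, hcr', min_eq_right h.le, if_neg h.not_gt, abs_of_neg (sub_neg.2 h)]
      ring
    · rw [hB₀, hcr', min_eq_left h.le, if_pos h, abs_of_pos (sub_pos.2 h)]
      ring
  have hc : 0 ≤ cr' := by
    rw [hcr']
    split_ifs <;> positivity
  have hC0 : 0 < j' * s' + k' * s + b + cr' := by positivity
  generalize a + n₁ + n₂ - 1 = A at *
  generalize j' * s' + k' * s + b + cr' = C at *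
  generalize n₂ * j' + n₁ * k' = D at *
  generalize min r r' = m at *
  have key : ∀ ρ ∈ Set.Ioi (0 : ℝ),
      ρ ^ A * Real.exp (-(ρ * B₀)) * ∫ μ in Set.Iic m, Real.exp (ρ * μ * D) =
        D⁻¹ * (ρ ^ (A - 1) * Real.exp (-(C * ρ))) := by
    intro ρ hρ
    have hρ : 0 < ρ := hρ
    simp_rw [mul_right_comm ρ _ D]
    rw [integral_exp_mul_Iic (mul_pos hρ hD), Real.rpow_sub_one hρ.ne',
      show -(C * ρ) = -(ρ * B₀) + ρ * D * m by rw [← hC]; ring, Real.exp_add]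
    field_simp
  rw [setIntegral_congr_fun measurableSet_Ioi key, integral_const_mul,
    Real.integral_rpow_mul_exp_neg_mul_Ioi hA hC0, Real.div_rpow zero_le_one hC0.le,
    Real.one_rpow]
  field_simp
end

section
/- Let d ≥ 1 be an integer, τ > 0, μ₀ ∈ ℝ^d, x ∈ ℝ^d, and let G be a probability measure on (0,∞). For k > 0 and m ∈ ℝ^d, v > 0, let φ(t; m, v) = (2πv)^{-d/2} exp(-‖t-m‖²/(2v)) denote the N_d(m, vI_d) density at t ∈ ℝ^d. Define the model density p(x|θ) = ∫ φ(x; θ, k) dG(k) for θ ∈ ℝ^d, the prior π(θ) = φ(θ; μ₀, τ²), and w(k) = (k+τ²)^{-d/2} exp(-‖x-μ₀‖²/(2(k+τ²))); note 0 < ∫ w dG < ∞. Then for every θ ∈ ℝ^d, the posterior density π(θ|x) := π(θ) p(x|θ) / ∫_{ℝ^d} π(θ') p(x|θ') dθ' satisfies π(θ|x) = ∫ φ(θ; x - (k/(τ²+k))(x-μ₀), τ²k/(τ²+k)) · (w(k)/∫w dG) dG(k). -/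
open MeasureTheory

/-- The density at `t` of the isotropic normal distribution with mean `m` and covariance `v I`. -/
noncomputable def isotropicNormalPDF {d : ℕ} (t m : EuclideanSpace ℝ (Fin d)) (v : ℝ) : ℝ :=
  (2 * Real.pi * v) ^ (-(d : ℝ) / 2) * Real.exp (-‖t - m‖ ^ 2 / (2 * v))

lemma isotropicNormalPDF_nonneg {d : ℕ} (t m : EuclideanSpace ℝ (Fin d)) {v : ℝ} (hv : 0 < v) :
    0 ≤ isotropicNormalPDF t m v := by
  unfold isotropicNormalPDF
  positivity

lemma integral_isotropicNormalPDF {d : ℕ} (m : EuclideanSpace ℝ (Fin d)) {v : ℝ} (hv : 0 < v) :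
    ∫ t, isotropicNormalPDF t m v = 1 := by
  unfold isotropicNormalPDF
  rw [integral_const_mul,
    integral_sub_right_eq_self
      (fun t : EuclideanSpace ℝ (Fin d) => Real.exp (-‖t‖ ^ 2 / (2 * v))) m]
  have hexp : ∀ t : EuclideanSpace ℝ (Fin d),
      Real.exp (-‖t‖ ^ 2 / (2 * v)) = Real.exp (-(1 / (2 * v)) * ‖t‖ ^ 2) := fun t => by
    congr 1
    ring
  simp_rw [hexp]
  rw [GaussianFourier.integral_rexp_neg_mul_sq_norm (by positivity), finrank_euclideanSpace_fin,
    show Real.pi / (1 / (2 * v)) = 2 * Real.pi * v by field_simp,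
    ← Real.rpow_add (by positivity)]
  simp [neg_div]

lemma integrable_isotropicNormalPDF {d : ℕ} (m : EuclideanSpace ℝ (Fin d)) {v : ℝ}
    (hv : 0 < v) : Integrable (fun t => isotropicNormalPDF t m v) :=
  .of_integral_ne_zero (by simp [integral_isotropicNormalPDF m hv])

lemma isotropicNormalPDF_mul_isotropicNormalPDF {d : ℕ} (θ μ₀ x : EuclideanSpace ℝ (Fin d))
    {s k : ℝ} (hs : 0 < s) (hk : 0 < k) :
    isotropicNormalPDF θ μ₀ s * isotropicNormalPDF x θ k =
      isotropicNormalPDF x μ₀ (k + s) *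
        isotropicNormalPDF θ (x - (k / (s + k)) • (x - μ₀)) (s * k / (s + k)) := by
  unfold isotropicNormalPDF
  rw [mul_mul_mul_comm, mul_mul_mul_comm ((2 * Real.pi * (k + s)) ^ (-(d : ℝ) / 2)),
    ← Real.mul_rpow (by positivity) (by positivity),
    ← Real.mul_rpow (by positivity) (by positivity), ← Real.exp_add, ← Real.exp_add]
  congr 2
  · field_simp
    ring
  · have hθμ : θ - μ₀ = (θ - x) + (x - μ₀) := by abel
    have hθm : θ - (x - (k / (s + k)) • (x - μ₀)) = (θ - x) + (k / (s + k)) • (x - μ₀) := by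
      abel
    rw [hθμ, hθm, norm_sub_rev x θ, norm_add_sq_real, norm_add_sq_real, inner_smul_right,
      norm_smul, mul_pow, Real.norm_eq_abs, sq_abs]
    field_simp
    ring

lemma integral_isotropicNormalPDF_mul_mixture {d : ℕ}
    (μ₀ x : EuclideanSpace ℝ (Fin d)) {s : ℝ} (hs : 0 < s) (G : Measure ℝ) [SFinite G]
    (hpos : ∀ᵐ k ∂G, 0 < k)
    (hint : Integrable (fun k => isotropicNormalPDF x μ₀ (k + s)) G) :
    ∫ θ, isotropicNormalPDF θ μ₀ s * ∫ k, isotropicNormalPDF x θ k ∂G =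
      ∫ k, isotropicNormalPDF x μ₀ (k + s) ∂G := by
  have hmarg : ∀ k, 0 < k →
      ∫ θ, isotropicNormalPDF θ μ₀ s * isotropicNormalPDF x θ k =
        isotropicNormalPDF x μ₀ (k + s) := fun k hk => by
    simp_rw [isotropicNormalPDF_mul_isotropicNormalPDF _ μ₀ x hs hk]
    rw [integral_const_mul, integral_isotropicNormalPDF _ (by positivity), mul_one]
  have hmeas : Measurable (fun z : EuclideanSpace ℝ (Fin d) × ℝ =>
      isotropicNormalPDF z.1 μ₀ s * isotropicNormalPDF x z.1 z.2) := by
    unfold isotropicNormalPDF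
    fun_prop
  have hprod : Integrable (fun z : EuclideanSpace ℝ (Fin d) × ℝ =>
      isotropicNormalPDF z.1 μ₀ s * isotropicNormalPDF x z.1 z.2) (volume.prod G) := by
    rw [integrable_prod_iff' hmeas.aestronglyMeasurable]
    constructor
    · filter_upwards [hpos] with k hk
      simp_rw [isotropicNormalPDF_mul_isotropicNormalPDF _ μ₀ x hs hk]
      exact (integrable_isotropicNormalPDF _ (by positivity)).const_mul _
    · refine hint.congr ?_
      filter_upwards [hpos] with k hk
      rw [← hmarg k hk]
      congr with θ
      rw [Real.norm_of_nonneg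
        (mul_nonneg (isotropicNormalPDF_nonneg _ _ hs) (isotropicNormalPDF_nonneg _ _ hk))]
  simp_rw [← integral_const_mul]
  rw [integral_integral_swap hprod]
  refine integral_congr_ae ?_
  filter_upwards [hpos] with k hk using hmarg k hk

/-- Example 4.1: for a variance mixture of normals X|θ,K ~ N_d(θ, K I_d), K ~ G, with a
normal prior θ ~ N_d(μ₀, τ² I_d), the posterior of θ given x is the mixture, over K' with
density ∝ w with respect to G, of the conditional normal posteriors. -/
theorem variance_mixture_normal_posterior
    (d : ℕ) (hd : 1 ≤ d) (τ : ℝ) (hτ : 0 < τ)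
    (μ₀ x : EuclideanSpace ℝ (Fin d))
    (G : Measure ℝ) [IsProbabilityMeasure G] (hG : G (Set.Iic 0) = 0)
    (φ : EuclideanSpace ℝ (Fin d) → EuclideanSpace ℝ (Fin d) → ℝ → ℝ)
    (hφ : ∀ t m v, φ t m v =
      (2 * Real.pi * v) ^ (-(d : ℝ) / 2) * Real.exp (-‖t - m‖ ^ 2 / (2 * v)))
    (p : EuclideanSpace ℝ (Fin d) → ℝ)
    (hp : ∀ θ, p θ = ∫ k, φ x θ k ∂G)
    (pri : EuclideanSpace ℝ (Fin d) → ℝ)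
    (hpri : ∀ θ, pri θ = φ θ μ₀ (τ ^ 2))
    (w : ℝ → ℝ)
    (hw : ∀ k, w k = (k + τ ^ 2) ^ (-(d : ℝ) / 2) *
      Real.exp (-‖x - μ₀‖ ^ 2 / (2 * (k + τ ^ 2)))) :
    (Integrable w G ∧ 0 < ∫ k, w k ∂G) ∧
    ∀ θ, pri θ * p θ / (∫ θ', pri θ' * p θ') =
      ∫ k, φ θ (x - (k / (τ ^ 2 + k)) • (x - μ₀)) (τ ^ 2 * k / (τ ^ 2 + k)) *
        (w k / ∫ j, w j ∂G) ∂G := by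
  obtain rfl : φ = isotropicNormalPDF := by
    funext t m v
    exact hφ t m v
  have hs : 0 < τ ^ 2 := by positivity
  have hpos : ∀ᵐ k ∂G, 0 < k := by
    rw [ae_iff]
    simpa [Set.Iic] using hG
  have hwmeas : Measurable w := by
    rw [funext hw]
    fun_prop
  have hw_int : Integrable w G := by
    refine .of_bound hwmeas.aestronglyMeasurable ((τ ^ 2) ^ (-(d : ℝ) / 2)) ?_
    filter_upwards [hpos] with k hk
    rw [hw, Real.norm_of_nonneg (by positivity), ← mul_one ((τ ^ 2) ^ (-(d : ℝ) / 2))]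
    refine mul_le_mul ?_ ?_ (by positivity) (by positivity)
    · exact Real.rpow_le_rpow_of_nonpos hs (by linarith)
        (div_nonpos_of_nonpos_of_nonneg (by simp) (by norm_num))
    · exact Real.exp_le_one_iff.2
        (div_nonpos_of_nonpos_of_nonneg (by simp) (by positivity))
  have hw_pos : ∀ᵐ k ∂G, 0 < w k := by
    filter_upwards [hpos] with k hk
    rw [hw]
    positivity
  have hw_integral : 0 < ∫ k, w k ∂G := by
    rw [integral_pos_iff_support_of_nonneg_ae (hw_pos.mono fun _ h => h.le) hw_int]
    have hsupp : Function.support w =ᵐ[G] Set.univ :=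
      Filter.eventuallyEq_univ.2 (hw_pos.mono fun _ h => h.ne')
    simp [measure_congr hsupp]
  refine ⟨⟨hw_int, hw_integral⟩, fun θ => ?_⟩
  set c : ℝ := (2 * Real.pi) ^ (-(d : ℝ) / 2) with hc
  have hc_pos : 0 < c := by positivity
  have hpdf : ∀ k, 0 < k → isotropicNormalPDF x μ₀ (k + τ ^ 2) = c * w k := fun k hk => by
    rw [hw, isotropicNormalPDF, Real.mul_rpow (by positivity) (by positivity), mul_assoc]
  have hpdf_ae : (fun k => c * w k) =ᵐ[G] fun k => isotropicNormalPDF x μ₀ (k + τ ^ 2) := by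
    filter_upwards [hpos] with k hk using (hpdf k hk).symm
  have hden : ∫ θ', pri θ' * p θ' = c * ∫ k, w k ∂G := by
    simp_rw [hpri, hp]
    rw [integral_isotropicNormalPDF_mul_mixture μ₀ x hs G hpos
      ((hw_int.const_mul c).congr hpdf_ae), ← integral_congr_ae hpdf_ae, integral_const_mul]
  rw [hden, hpri, hp, ← integral_const_mul, ← integral_div]
  refine integral_congr_ae ?_
  filter_upwards [hpos] with k hk
  rw [isotropicNormalPDF_mul_isotropicNormalPDF θ μ₀ x hs hk, hpdf k hk]
  field_simp
end

section
/- Let γ₁, γ₂, γ₄ > 0, γ₃ > γ₅ ≥ 0, and γ₁ + γ₂ + γ₄ > 1. Then ∫₀^∞ ∫_{z₁}^∞ z₁^{γ₁-1} (z₂-z₁)^{γ₂-1} z₂^{γ₄-1} e^{-γ₃z₂ - γ₅z₁} dz₂ dz₁ = [Γ(γ₁)Γ(γ₂)/Γ(γ₁+γ₂)] · [Γ(γ₁+γ₂+γ₄-1)/γ₃^{γ₁+γ₂+γ₄-1}] · ₂F₁(γ₁, γ₁+γ₂+γ₄-1; γ₁+γ₂; -γ₅/γ₃), where ₂F₁(α,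 β; γ; z) = Σ_{k≥0} (α)_k (β)_k z^k/((γ)_k k!) with (α)_k = Γ(α+k)/Γ(α) (the series converges since |γ₅/γ₃| < 1). -/
open MeasureTheory

/-- The Euler integral of the first kind on `(0, y)`, in real form. -/
lemma integral_Ioo_rpow_mul_sub_rpow {a b y : ℝ} (ha : 0 < a) (hb : 0 < b) (hy : 0 < y) :
    ∫ x in Set.Ioo 0 y, x ^ (a - 1) * (y - x) ^ (b - 1) =
      y ^ (a + b - 1) * (Real.Gamma a * Real.Gamma b / Real.Gamma (a + b)) := by
  have h := Complex.betaIntegral_scaled (a : ℂ) (b : ℂ) hy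
  rw [Complex.betaIntegral_eq_Gamma_mul_div _ _ (by simpa using ha) (by simpa using hb),
    intervalIntegral.integral_of_le hy.le, integral_Ioc_eq_integral_Ioo] at h
  have hcongr : ∀ x ∈ Set.Ioo 0 y, (x : ℂ) ^ ((a : ℂ) - 1) * ((y : ℂ) - x) ^ ((b : ℂ) - 1) =
      ((x ^ (a - 1) * (y - x) ^ (b - 1) : ℝ) : ℂ) := by
    intro x hx
    rw [Complex.ofReal_mul, Complex.ofReal_cpow hx.1.le,
      Complex.ofReal_cpow (sub_nonneg.mpr hx.2.le)]
    push_cast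
    rfl
  rw [setIntegral_congr_fun measurableSet_Ioo hcongr, integral_complex_ofReal] at h
  have hpow : (y : ℂ) ^ ((a : ℂ) + b - 1) = ((y ^ (a + b - 1) : ℝ) : ℂ) := by
    rw [Complex.ofReal_cpow hy.le]
    push_cast
    rfl
  rw [hpow, ← Complex.ofReal_add, Complex.Gamma_ofReal, Complex.Gamma_ofReal,
    Complex.Gamma_ofReal] at h
  exact_mod_cast h

/-- The unnormalized density of the generalized McKay distribution with `γ₅ = 0`, extended by zero
to the plane. -/
noncomputable def mcKayKernel (a b c d : ℝ) : ℝ × ℝ → ℝ :=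
  {p : ℝ × ℝ | 0 < p.1 ∧ p.1 < p.2}.indicator fun p ↦
    p.1 ^ (a - 1) * (p.2 - p.1) ^ (b - 1) * p.2 ^ (d - 1) * Real.exp (-(c * p.2))

lemma measurableSet_pos_lt : MeasurableSet {p : ℝ × ℝ | 0 < p.1 ∧ p.1 < p.2} :=
  (measurableSet_lt measurable_const measurable_fst).inter
    (measurableSet_lt measurable_fst measurable_snd)

lemma measurable_mcKayKernel (a b c d : ℝ) : Measurable (mcKayKernel a b c d) :=
  Measurable.indicator (by fun_prop) measurableSet_pos_lt

lemma mcKayKernel_nonneg (a b c d : ℝ) (p : ℝ × ℝ) : 0 ≤ mcKayKernel a b c d p := by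
  refine Set.indicator_nonneg (fun p hp ↦ ?_) p
  have h₁ : 0 < p.1 := hp.1
  have h₂ : 0 < p.2 - p.1 := sub_pos.mpr hp.2
  have h₃ : 0 < p.2 := h₁.trans hp.2
  positivity

lemma mcKayKernel_section {y : ℝ} (a b c d : ℝ) :
    (fun x ↦ mcKayKernel a b c d (x, y)) = (Set.Ioo 0 y).indicator fun x ↦
      x ^ (a - 1) * (y - x) ^ (b - 1) * (y ^ (d - 1) * Real.exp (-(c * y))) := by
  ext x
  by_cases hx : x ∈ Set.Ioo 0 y
  · rw [Set.indicator_of_mem hx, mcKayKernel, Set.indicator_of_mem (by exact hx)]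
    ring
  · rw [Set.indicator_of_notMem hx, mcKayKernel, Set.indicator_of_notMem (by exact hx)]

lemma integral_mcKayKernel_section {a b : ℝ} (c d : ℝ) (ha : 0 < a) (hb : 0 < b) :
    (fun y ↦ ∫ x, mcKayKernel a b c d (x, y)) = (Set.Ioi 0).indicator fun y ↦
      Real.Gamma a * Real.Gamma b / Real.Gamma (a + b) *
        (y ^ (a + b + d - 1 - 1) * Real.exp (-(c * y))) := by
  ext y
  rw [mcKayKernel_section, integral_indicator measurableSet_Ioo]
  by_cases hy : 0 < y
  · rw [Set.indicator_of_mem (by exact hy), integral_mul_const,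
      integral_Ioo_rpow_mul_sub_rpow ha hb hy,
      show a + b + d - 1 - 1 = (a + b - 1) + (d - 1) by ring, Real.rpow_add hy]
    ring
  · rw [Set.indicator_of_notMem (by exact hy), Set.Ioo_eq_empty hy]
    simp

lemma integrable_mcKayKernel {a b c d : ℝ} (ha : 0 < a) (hb : 0 < b) (hc : 0 < c)
    (hs : 0 < a + b + d - 1) : Integrable (mcKayKernel a b c d) := by
  rw [Measure.volume_eq_prod,
    integrable_prod_iff' (measurable_mcKayKernel a b c d).aestronglyMeasurable]
  constructor
  · refine Filter.Eventually.of_forall fun y ↦ ?_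
    rw [mcKayKernel_section, integrable_indicator_iff measurableSet_Ioo]
    refine Integrable.mul_const ?_ _
    by_cases hy : 0 < y
    · refine Integrable.of_integral_ne_zero ?_
      rw [integral_Ioo_rpow_mul_sub_rpow ha hb hy]
      have := Real.Gamma_pos_of_pos ha
      have := Real.Gamma_pos_of_pos hb
      have := Real.Gamma_pos_of_pos (add_pos ha hb)
      positivity
    · simp [Set.Ioo_eq_empty hy]
  · simp_rw [Real.norm_of_nonneg (mcKayKernel_nonneg a b c d _)]
    rw [integral_mcKayKernel_section c d ha hb, integrable_indicator_iff measurableSet_Ioi]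
    refine Integrable.const_mul (Integrable.of_integral_ne_zero ?_) _
    rw [Real.integral_rpow_mul_exp_neg_mul_Ioi hs hc]
    have := Real.Gamma_pos_of_pos hs
    positivity

lemma integral_mcKayKernel {a b c d : ℝ} (ha : 0 < a) (hb : 0 < b) (hc : 0 < c)
    (hs : 0 < a + b + d - 1) :
    ∫ p, mcKayKernel a b c d p = Real.Gamma a * Real.Gamma b / Real.Gamma (a + b) *
      (Real.Gamma (a + b + d - 1) / c ^ (a + b + d - 1)) := by
  have hint := integrable_mcKayKernel ha hb hc hs
  rw [Measure.volume_eq_prod] at hint ⊢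
  rw [integral_prod_symm _ hint, integral_mcKayKernel_section c d ha hb,
    integral_indicator measurableSet_Ioi, integral_const_mul,
    Real.integral_rpow_mul_exp_neg_mul_Ioi hs hc, Real.div_rpow zero_le_one hc.le, Real.one_rpow]
  ring

lemma mcKayKernel_add_nat (a b c d : ℝ) (k : ℕ) (p : ℝ × ℝ) :
    mcKayKernel (a + k) b c d p = p.1 ^ k * mcKayKernel a b c d p := by
  by_cases hp : p ∈ {p : ℝ × ℝ | 0 < p.1 ∧ p.1 < p.2}
  · rw [mcKayKernel, mcKayKernel, Set.indicator_of_mem hp, Set.indicator_of_mem hp,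
      show a + k - 1 = (a - 1) + k by ring, Real.rpow_add hp.1, Real.rpow_natCast]
    ring
  · rw [mcKayKernel, mcKayKernel, Set.indicator_of_notMem hp, Set.indicator_of_notMem hp, mul_zero]

/-- Convergence of the Gauss hypergeometric series inside the unit disc, in terms of `Γ`. -/
lemma summable_Gamma_mul_Gamma_div_Gamma_mul_pow {α β γ r : ℝ} (hα : 0 < α) (hβ : 0 < β)
    (hγ : 0 < γ) (hr₀ : 0 ≤ r) (hr₁ : r < 1) :
    Summable fun k : ℕ ↦ Real.Gamma (α + k) * Real.Gamma (β + k) /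
      (Real.Gamma (γ + k) * (k.factorial : ℝ)) * r ^ k := by
  have hlim : Filter.Tendsto
      (fun k : ℕ ↦ (α + k) / (γ + k) * ((β + k) / (1 + k)) * r) Filter.atTop (nhds (1 * 1 * r)) := by
    have key : ∀ u v : ℝ, 0 < v →
        Filter.Tendsto (fun k : ℕ ↦ (u + k) / (v + k)) Filter.atTop (nhds 1) := by
      intro u v hv
      simpa using tendsto_add_mul_div_add_mul_atTop_nhds u v (1 : ℝ) one_ne_zero
    exact ((key α γ hγ).mul (key β 1 one_pos)).mul_const r
  obtain ⟨q, hrq, hq⟩ := exists_between hr₁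
  rw [one_mul, one_mul] at hlim
  refine summable_of_ratio_norm_eventually_le hq ?_
  filter_upwards [hlim.eventually_lt_const hrq] with k hk
  have hGα := Real.Gamma_pos_of_pos (show 0 < α + k by positivity)
  have hGβ := Real.Gamma_pos_of_pos (show 0 < β + k by positivity)
  have hGγ := Real.Gamma_pos_of_pos (show 0 < γ + k by positivity)
  have hstep : ∀ u : ℝ, 0 < u →
      Real.Gamma (u + (k + 1 : ℕ)) = (u + k) * Real.Gamma (u + k) := by
    intro u hu
    rw [← Real.Gamma_add_one (by positivity)]
    push_cast
    ring_nf
  rw [hstep α hα, hstep β hβ, hstep γ hγ, Real.norm_of_nonneg (by positivity),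
    Real.norm_of_nonneg (by positivity), Nat.factorial_succ]
  refine le_trans (le_of_eq ?_) (mul_le_mul_of_nonneg_right hk.le (by positivity))
  push_cast
  field_simp
  ring

/-- Appendix item B, formula (4.13): the normalizing constant of the generalized McKay
distribution MG(γ₁,γ₂,γ₃,γ₄,γ₅). -/
theorem generalized_mckay_normalizing_constant
    (γ₁ γ₂ γ₃ γ₄ γ₅ : ℝ)
    (hγ₁ : 0 < γ₁) (hγ₂ : 0 < γ₂) (hγ₄ : 0 < γ₄)
    (hγ₅ : 0 ≤ γ₅) (hγ₃ : γ₅ < γ₃) (hsum : 1 < γ₁ + γ₂ + γ₄) :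
    (∫ z₁ in Set.Ioi (0 : ℝ), ∫ z₂ in Set.Ioi z₁,
        z₁ ^ (γ₁ - 1) * (z₂ - z₁) ^ (γ₂ - 1) * z₂ ^ (γ₄ - 1) *
          Real.exp (-(γ₃ * z₂) - γ₅ * z₁)) =
      (Real.Gamma γ₁ * Real.Gamma γ₂ / Real.Gamma (γ₁ + γ₂)) *
        (Real.Gamma (γ₁ + γ₂ + γ₄ - 1) / γ₃ ^ (γ₁ + γ₂ + γ₄ - 1)) *
        (∑' k : ℕ,
          (Real.Gamma (γ₁ + k) / Real.Gamma γ₁) *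
            (Real.Gamma (γ₁ + γ₂ + γ₄ - 1 + k) / Real.Gamma (γ₁ + γ₂ + γ₄ - 1)) *
            (-(γ₅ / γ₃)) ^ k /
            ((Real.Gamma (γ₁ + γ₂ + k) / Real.Gamma (γ₁ + γ₂)) * (Nat.factorial k : ℝ))) := by
  have hc : 0 < γ₃ := hγ₅.trans_lt hγ₃
  have hs : 0 < γ₁ + γ₂ + γ₄ - 1 := by linarith
  set K := mcKayKernel γ₁ γ₂ γ₃ γ₄ with hK
  set F : ℕ → ℝ × ℝ → ℝ := fun k p ↦
    (-γ₅) ^ k / (k.factorial : ℝ) * mcKayKernel (γ₁ + k) γ₂ γ₃ γ₄ p with hF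
  have hsk : ∀ k : ℕ, 0 < γ₁ + k + γ₂ + γ₄ - 1 := fun k ↦ by
    have : (0 : ℝ) ≤ k := k.cast_nonneg
    linarith
  have hF_int : ∀ k, Integrable (F k) := fun k ↦
    (integrable_mcKayKernel (by positivity) hγ₂ hc (hsk k)).const_mul _
  have hval : ∀ k : ℕ, ∫ p, mcKayKernel (γ₁ + k) γ₂ γ₃ γ₄ p =
      Real.Gamma γ₂ / γ₃ ^ (γ₁ + γ₂ + γ₄ - 1) * (Real.Gamma (γ₁ + k) *
        Real.Gamma (γ₁ + γ₂ + γ₄ - 1 + k) / Real.Gamma (γ₁ + γ₂ + k) / γ₃ ^ k) := by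
    intro k
    rw [integral_mcKayKernel (by positivity) hγ₂ hc (hsk k),
      show γ₁ + k + γ₂ + γ₄ - 1 = γ₁ + γ₂ + γ₄ - 1 + k by ring,
      show γ₁ + k + γ₂ = γ₁ + γ₂ + k by ring, Real.rpow_add hc, Real.rpow_natCast]
    ring
  have hF_sum : Summable fun k ↦ ∫ p, ‖F k p‖ := by
    refine ((summable_Gamma_mul_Gamma_div_Gamma_mul_pow hγ₁ hs (add_pos hγ₁ hγ₂)
      (div_nonneg hγ₅ hc.le) ((div_lt_one hc).mpr hγ₃)).mul_left
      (Real.Gamma γ₂ / γ₃ ^ (γ₁ + γ₂ + γ₄ - 1))).congr fun k ↦ ?_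
    simp_rw [hF, norm_mul, Real.norm_of_nonneg (mcKayKernel_nonneg _ _ _ _ _)]
    rw [integral_const_mul, hval, norm_div, norm_pow, norm_neg, Real.norm_of_nonneg hγ₅,
      Real.norm_of_nonneg (Nat.cast_nonneg _), div_pow]
    ring
  have hsum_F : ∀ p, ∑' k, F k p = Real.exp (-γ₅ * p.1) * K p := by
    intro p
    rw [Real.exp_eq_exp_ℝ, NormedSpace.exp_eq_tsum_div, ← tsum_mul_right]
    refine tsum_congr fun k ↦ ?_
    rw [hF, hK]
    simp only
    rw [mcKayKernel_add_nat, mul_pow]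
    ring
  have hint : Integrable fun p : ℝ × ℝ ↦ Real.exp (-γ₅ * p.1) * K p := by
    refine (integrable_mcKayKernel hγ₁ hγ₂ hc hs).mono
      ((by fun_prop : Measurable fun p : ℝ × ℝ ↦ Real.exp (-γ₅ * p.1)).mul
        (measurable_mcKayKernel _ _ _ _)).aestronglyMeasurable
      (Filter.Eventually.of_forall fun p ↦ ?_)
    by_cases hp : p ∈ {p : ℝ × ℝ | 0 < p.1 ∧ p.1 < p.2}
    · rw [norm_mul, Real.norm_of_nonneg (Real.exp_pos _).le]
      refine mul_le_of_le_one_left (norm_nonneg _) (Real.exp_le_one_iff.mpr ?_)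
      nlinarith [mul_nonneg hγ₅ hp.1.le]
    · simp [hK, mcKayKernel, Set.indicator_of_notMem hp]
  have hlhs : (∫ z₁ in Set.Ioi (0 : ℝ), ∫ z₂ in Set.Ioi z₁,
      z₁ ^ (γ₁ - 1) * (z₂ - z₁) ^ (γ₂ - 1) * z₂ ^ (γ₄ - 1) *
        Real.exp (-(γ₃ * z₂) - γ₅ * z₁)) = ∫ p : ℝ × ℝ, Real.exp (-γ₅ * p.1) * K p := by
    rw [Measure.volume_eq_prod] at hint ⊢
    rw [integral_prod _ hint, ← integral_indicator measurableSet_Ioi]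
    refine integral_congr_ae (Filter.Eventually.of_forall fun x ↦ ?_)
    by_cases hx : 0 < x
    · simp only
      rw [Set.indicator_of_mem (by exact hx), ← integral_indicator measurableSet_Ioi]
      refine integral_congr_ae (Filter.Eventually.of_forall fun y ↦ ?_)
      by_cases hy : x < y
      · simp only [hK, mcKayKernel]
        rw [Set.indicator_of_mem (by exact hy), Set.indicator_of_mem (by exact ⟨hx, hy⟩),
          sub_eq_add_neg _ (γ₅ * x), Real.exp_add, neg_mul]
        ring
      · simp [hK, mcKayKernel, hy]
    · simp [hK, mcKayKernel, hx]
  rw [hlhs, ← integral_congr_ae (Filter.Eventually.of_forall hsum_F),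
    ← (hasSum_integral_of_summable_integral_norm hF_int hF_sum).tsum_eq, ← tsum_mul_left]
  refine tsum_congr fun k ↦ ?_
  rw [hF]
  simp only
  rw [integral_const_mul, hval]
  have := Real.Gamma_pos_of_pos hγ₁
  have := Real.Gamma_pos_of_pos (add_pos hγ₁ hγ₂)
  have := Real.Gamma_pos_of_pos hs
  have := Real.Gamma_pos_of_pos (show 0 < γ₁ + γ₂ + k by positivity)
  have := Real.rpow_pos_of_pos hc (γ₁ + γ₂ + γ₄ - 1)
  rw [← neg_div, div_pow]
  field_simp
end

section
/- Let γ₁, γ₂, γ₄ > 0, γ₃ > γ₅ ≥ 0, and γ₁ + γ₂ + γ₄ > 1, and let C(γ⃗) = [Γ(γ₁)Γ(γ₂)/Γ(γ₁+γ₂)] · [Γ(γ₁+γ₂+γ₄-1)/γ₃^{γ₁+γ₂+γ₄-1}] · ₂F₁(γ₁, γ₁+γ₂+γ₄-1; γ₁+γ₂; -γ₅/γ₃), where ₂F₁(α, β; γ; z) = Σ_{k≥0} (α)_k (β)_k z^k/((γ)_k k!). Let f(z₁,z₂) = (1/C(γ⃗)) z₁^{γ₁-1}(z₂-z₁)^{γ₂-1}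 z₂^{γ₄-1} e^{-γ₃z₂-γ₅z₁} on 0 < z₁ < z₂ (and 0 elsewhere). Then for every t₁ ∈ (0,1): ∫₀^∞ f(t₁t₂, t₂) · t₂ dt₂ = [Γ(γ₁+γ₂)/(Γ(γ₁)Γ(γ₂))] · t₁^{γ₁-1}(1-t₁)^{γ₂-1} / ₂F₁(γ₁, γ₁+γ₂+γ₄-1; γ₁+γ₂; -γ₅/γ₃) · (γ₃/(γ₃+γ₅t₁))^{γ₁+γ₂+γ₄-1}. -/
open MeasureTheory

/-- Appendix item A: the marginal density of T₁ = Z₁/Z₂ for the generalized McKay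
distribution is a Gauss hypergeometric distribution on (0,1). -/
theorem generalized_mckay_ratio_marginal
    (γ₁ γ₂ γ₃ γ₄ γ₅ : ℝ)
    (hγ₁ : 0 < γ₁) (hγ₂ : 0 < γ₂) (hγ₄ : 0 < γ₄)
    (hγ₅ : 0 ≤ γ₅) (hγ₃ : γ₅ < γ₃) (hsum : 1 < γ₁ + γ₂ + γ₄)
    (F21 : ℝ)
    (hF21 : F21 = ∑' k : ℕ,
      (Real.Gamma (γ₁ + k) / Real.Gamma γ₁) *
        (Real.Gamma (γ₁ + γ₂ + γ₄ - 1 + k) / Real.Gamma (γ₁ + γ₂ + γ₄ - 1)) *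
        (-(γ₅ / γ₃)) ^ k /
        ((Real.Gamma (γ₁ + γ₂ + k) / Real.Gamma (γ₁ + γ₂)) * (Nat.factorial k : ℝ)))
    (C : ℝ)
    (hC : C = (Real.Gamma γ₁ * Real.Gamma γ₂ / Real.Gamma (γ₁ + γ₂)) *
      (Real.Gamma (γ₁ + γ₂ + γ₄ - 1) / γ₃ ^ (γ₁ + γ₂ + γ₄ - 1)) * F21)
    (f : ℝ → ℝ → ℝ)
    (hf : ∀ z₁ z₂, f z₁ z₂ = if 0 < z₁ ∧ z₁ < z₂ then
      (1 / C) * (z₁ ^ (γ₁ - 1) * (z₂ - z₁) ^ (γ₂ - 1) * z₂ ^ (γ₄ - 1) *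
        Real.exp (-(γ₃ * z₂) - γ₅ * z₁)) else 0) :
    ∀ t₁ : ℝ, 0 < t₁ → t₁ < 1 →
      (∫ t₂ in Set.Ioi (0 : ℝ), f (t₁ * t₂) t₂ * t₂) =
        (Real.Gamma (γ₁ + γ₂) / (Real.Gamma γ₁ * Real.Gamma γ₂)) *
          (t₁ ^ (γ₁ - 1) * (1 - t₁) ^ (γ₂ - 1) / F21) *
          (γ₃ / (γ₃ + γ₅ * t₁)) ^ (γ₁ + γ₂ + γ₄ - 1) := by
  intro t ht0 ht1
  have hγ₃_pos : 0 < γ₃ := hγ₅.trans_lt hγ₃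
  have hs : 0 < γ₁ + γ₂ + γ₄ - 1 := by linarith
  have hr : 0 < γ₃ + γ₅ * t := by positivity
  have h1t : 0 < 1 - t := by linarith
  have hintegrand : ∀ x ∈ Set.Ioi (0 : ℝ), f (t * x) x * x =
      (1 / C * (t ^ (γ₁ - 1) * (1 - t) ^ (γ₂ - 1))) *
        (x ^ (γ₁ + γ₂ + γ₄ - 1 - 1) * Real.exp (-((γ₃ + γ₅ * t) * x))) := by
    intro x hx
    have hx : 0 < x := hx
    have hpow : x ^ (γ₁ + γ₂ + γ₄ - 1 - 1) =
        x ^ (γ₁ - 1) * x ^ (γ₂ - 1) * x ^ (γ₄ - 1) * x := by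
      rw [← Real.rpow_add hx, ← Real.rpow_add hx, ← Real.rpow_add_one hx.ne']
      congr 1
      ring
    rw [hf, if_pos ⟨mul_pos ht0 hx, by nlinarith⟩, show x - t * x = (1 - t) * x by ring,
      Real.mul_rpow ht0.le hx.le, Real.mul_rpow h1t.le hx.le, hpow,
      show -(γ₃ * x) - γ₅ * (t * x) = -((γ₃ + γ₅ * t) * x) by ring]
    ring
  rw [setIntegral_congr_fun measurableSet_Ioi hintegrand, integral_const_mul,
    Real.integral_rpow_mul_exp_neg_mul_Ioi hs hr, hC, Real.div_rpow hγ₃_pos.le hr.le,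
    Real.div_rpow zero_le_one hr.le, Real.one_rpow]
  have hΓ₁ := (Real.Gamma_pos_of_pos hγ₁).ne'
  have hΓ₂ := (Real.Gamma_pos_of_pos hγ₂).ne'
  have hΓ₁₂ := (Real.Gamma_pos_of_pos (add_pos hγ₁ hγ₂)).ne'
  have hΓs := (Real.Gamma_pos_of_pos hs).ne'
  have hγ₃s := (Real.rpow_pos_of_pos hγ₃_pos (γ₁ + γ₂ + γ₄ - 1)).ne'
  have hrs := (Real.rpow_pos_of_pos hr (γ₁ + γ₂ + γ₄ - 1)).ne'
  clear hF21 hC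
  generalize γ₃ ^ (γ₁ + γ₂ + γ₄ - 1) = a at *
  generalize (γ₃ + γ₅ * t) ^ (γ₁ + γ₂ + γ₄ - 1) = b at *
  generalize Real.Gamma (γ₁ + γ₂ + γ₄ - 1) = g at *
  generalize t ^ (γ₁ - 1) = u
  generalize (1 - t) ^ (γ₂ - 1) = v
  field_simp
end

section
/- Let γ₁, γ₂, γ₄ > 0 and γ₃ > γ₅ ≥ 0, and define ψ(γ₁', γ₂', γ₃') = (1/Γ(γ₁')) ∫₀^∞ t^{γ₁'-1} (1+t)^{γ₂'-γ₁'-1} e^{-γ₃'t} dt for γ₁', γ₃' > 0 and γ₂' ∈ ℝ (the confluent hypergeometric function of type II). Then for every z₁ > 0: ∫_{z₁}^∞ z₁^{γ₁-1} (z₂-z₁)^{γ₂-1} z₂^{γ₄-1} e^{-γ₃z₂ - γ₅z₁} dz₂ = Γ(γ₂) · z₁^{γ₁+γ₂+γ₄-2} · e^{-(γ₃+γ₅)z₁} · ψ(γ₂, γ₂+γ₄, γ₃z₁). -/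
open MeasureTheory

/-- The affine substitution `x = a + b * t` on a half-line. -/
theorem integral_Ioi_eq_mul_integral_comp_affine (f : ℝ → ℝ) (a : ℝ) {b : ℝ} (hb : 0 < b) :
    ∫ x in Set.Ioi a, f x = b * ∫ t in Set.Ioi (0 : ℝ), f (a + b * t) := by
  have hshift : ∫ x in Set.Ioi (0 : ℝ), f (a + x) = ∫ x in Set.Ioi a, f x := by
    simpa using (measurePreserving_add_left volume a).setIntegral_preimage_emb
      (measurableEmbedding_addLeft a) f (Set.Ioi a)
  rw [integral_comp_mul_left_Ioi (fun x => f (a + x)) 0 hb, mul_zero, hshift, smul_eq_mul,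
    mul_inv_cancel_left₀ (ne_of_gt hb)]

/-- Appendix item C: the marginal density of Z₁ for the generalized McKay distribution,
expressed through the confluent hypergeometric function of type II. -/
theorem generalized_mckay_first_marginal
    (γ₁ γ₂ γ₃ γ₄ γ₅ : ℝ)
    (hγ₁ : 0 < γ₁) (hγ₂ : 0 < γ₂) (hγ₄ : 0 < γ₄)
    (hγ₅ : 0 ≤ γ₅) (hγ₃ : γ₅ < γ₃)
    (ψ : ℝ → ℝ → ℝ → ℝ)
    (hψ : ∀ a b c, ψ a b c = (1 / Real.Gamma a) *
      ∫ t in Set.Ioi (0 : ℝ), t ^ (a - 1) * (1 + t) ^ (b - a - 1) * Real.exp (-(c * t))) :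
    ∀ z₁ : ℝ, 0 < z₁ →
      (∫ z₂ in Set.Ioi z₁,
          z₁ ^ (γ₁ - 1) * (z₂ - z₁) ^ (γ₂ - 1) * z₂ ^ (γ₄ - 1) *
            Real.exp (-(γ₃ * z₂) - γ₅ * z₁)) =
        Real.Gamma γ₂ * z₁ ^ (γ₁ + γ₂ + γ₄ - 2) * Real.exp (-((γ₃ + γ₅) * z₁)) *
          ψ γ₂ (γ₂ + γ₄) (γ₃ * z₁) := by
  intro z hz
  have hΓ : Real.Gamma γ₂ ≠ 0 := (Real.Gamma_pos_of_pos hγ₂).ne'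
  have hpow : z * (z ^ (γ₁ - 1) * z ^ (γ₂ - 1) * z ^ (γ₄ - 1)) = z ^ (γ₁ + γ₂ + γ₄ - 2) := by
    nth_rewrite 1 [← Real.rpow_one z]
    simp only [← Real.rpow_add hz]
    ring_nf
  have hintegrand : ∀ t ∈ Set.Ioi (0 : ℝ),
      z ^ (γ₁ - 1) * (z + z * t - z) ^ (γ₂ - 1) * (z + z * t) ^ (γ₄ - 1) *
          Real.exp (-(γ₃ * (z + z * t)) - γ₅ * z) =
        z ^ (γ₁ - 1) * z ^ (γ₂ - 1) * z ^ (γ₄ - 1) * Real.exp (-((γ₃ + γ₅) * z)) *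
          (t ^ (γ₂ - 1) * (1 + t) ^ (γ₂ + γ₄ - γ₂ - 1) * Real.exp (-(γ₃ * z * t))) := by
    intro t ht
    have ht : 0 < t := ht
    have hexp : -(γ₃ * (z + z * t)) - γ₅ * z = -((γ₃ + γ₅) * z) + -(γ₃ * z * t) := by ring
    rw [hexp, Real.exp_add, add_sub_cancel_left, add_sub_cancel_left,
      show z + z * t = z * (1 + t) by ring, Real.mul_rpow hz.le ht.le,
      Real.mul_rpow hz.le (by positivity)]
    ring
  rw [integral_Ioi_eq_mul_integral_comp_affine _ z hz,
    setIntegral_congr_fun measurableSet_Ioi hintegrand, integral_const_mul, hψ, ← hpow]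
  field_simp
end
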